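/- arXiv:2203.15400 — 12 statements merged into one kernel-verified Lean document; each statement's English description precedes it below -/
import Mathlib

section
/- Let U and Ω be sets, f : Finset U → Ω a sketch map, and u : Ω → U → Ω an update rule satisfying f(insert x A) = u(f(A), x) for every finite set A ⊆ U and every x ∈ U. Fix a finite set D ⊆ U and let K(D) := {i ∈ D : f(D \ {i}) ≠ f(D)}. Then the map Λ ↦ f(Λ) is injective on the collection of subsets Λ ⊆ K(D); consequently Ω has at least 2^{|K(D)|} elements, and if the sketch can be stored in b bits (i.e. |Ω| ≤ 2^b) then |K(D)| ≤ b. -/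
/-!
STATEMENT 0: A hash-based, order- and duplication-invariant sketch `f` computed
incrementally via an update rule `u` is injective on subsets of the set
`K(D) = {i ∈ D : f(D \ {i}) ≠ f(D)}`; hence the state space has at least
`2^{|K(D)|}` elements, and a sketch storable in `b` bits has `|K(D)| ≤ b`.
-/

attribute [local instance] Classical.propDecidable

theorem sketch_injective_on_subsets_of_K
    {U : Type*} {Ω : Type*} [Fintype Ω]
    (f : Finset U → Ω) (u : Ω → U → Ω)
    (hupd : ∀ (A : Finset U) (x : U), f (insert x A) = u (f A) x)
    (D : Finset U) :
    Set.InjOn f {Λ : Finset U | Λ ⊆ D.filter fun i => f (D.erase i) ≠ f D} ∧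
      2 ^ (D.filter fun i => f (D.erase i) ≠ f D).card ≤ Fintype.card Ω ∧
      ∀ b : ℕ, Fintype.card Ω ≤ 2 ^ b →
        (D.filter fun i => f (D.erase i) ≠ f D).card ≤ b := by
  have hun : ∀ (C A B : Finset U), f A = f B → f (C ∪ A) = f (C ∪ B) := by
    intro C A B h
    induction C using Finset.induction_on with
    | empty => simpa using h
    | insert x C _ ih => rw [Finset.insert_union, Finset.insert_union, hupd, hupd, ih]
  have key : ∀ A B : Finset U, A ⊆ (D.filter fun i => f (D.erase i) ≠ f D) →
      B ⊆ (D.filter fun i => f (D.erase i) ≠ f D) → f A = f B → A ⊆ B := by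
    intro A B hA hB h i hi
    by_contra hiB
    have hiK := Finset.mem_filter.1 (hA hi)
    have h1 : D.erase i ∪ A = D := by
      ext j
      have hj : j ∈ A → j ∈ D := fun hj => (Finset.mem_filter.1 (hA hj)).1
      simp only [Finset.mem_union, Finset.mem_erase]
      by_cases hji : j = i
      · subst hji
        simp [hi, hiK.1]
      · tauto
    have h2 : D.erase i ∪ B = D.erase i := by
      apply Finset.union_eq_left.2
      intro j hj
      refine Finset.mem_erase.2 ⟨?_, (Finset.mem_filter.1 (hB hj)).1⟩
      rintro rfl
      exact hiB hj
    have h3 := hun (D.erase i) A B h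
    rw [h1, h2] at h3
    exact hiK.2 h3.symm
  have hinj : Set.InjOn f {Λ : Finset U | Λ ⊆ D.filter fun i => f (D.erase i) ≠ f D} :=
    fun A hA B hB h => Finset.Subset.antisymm (key A B hA hB h) (key B A hB hA h.symm)
  have hcard : 2 ^ (D.filter fun i => f (D.erase i) ≠ f D).card ≤ Fintype.card Ω := by
    rw [← Finset.card_powerset, ← Finset.card_univ]
    refine Finset.card_le_card_of_injOn f (fun _ _ => Finset.mem_coe.2 (Finset.mem_univ _)) ?_
    intro A hA B hB h
    exact hinj (Finset.mem_powerset.1 hA) (Finset.mem_powerset.1 hB) h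
  exact ⟨hinj, hcard, fun b hb =>
    (Nat.pow_le_pow_iff_right (by norm_num)).1 (hcard.trans hb)⟩
end

section
/- Suppose the number of distinct stream items n is strictly greater than the supremum over all outcomes of K_r. Then Pr(K_r = n) = 0, and for every state s ∈ Ω with Pr(S_{n−1} = s) > 0, Pr(S_n = s) / Pr(S_{n−1} = s) = Σ_{j=1}^{n} Pr(J = j | f(A_{n,−j}) = s). -/
open MeasureTheory

attribute [local instance] Classical.propDecidable

/-- The set of hash values realized by a stream of `n` i.i.d. draws. -/
noncomputable def Afull {H : Type*} {n : ℕ} (ω : Fin n → H) : Finset H :=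
  Finset.image ω Finset.univ

/-- The set of hash values realized by the stream with the `i`-th item removed. -/
noncomputable def Aerase {H : Type*} {n : ℕ} (i : Fin n) (ω : Fin n → H) : Finset H :=
  Finset.image ω (Finset.univ.erase i)

/-- The (random) set of indices whose removal changes the sketch. -/
noncomputable def Kset {H : Type*} {Ω : Type*} (f : Finset H → Ω) {n : ℕ}
    (ω : Fin n → H) : Finset (Fin n) :=
  Finset.univ.filter fun i => f (Aerase i ω) ≠ f (Afull ω)

/-- The law of a stream of `n` i.i.d. hash values, each with law `μ`. -/
noncomputable def streamP {H : Type*} [MeasurableSpace H] (μ : Measure H) (n : ℕ) :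
    Measure (Fin n → H) :=
  Measure.pi fun _ => μ

/-!
STATEMENT 1: If the number of distinct stream items `n` strictly exceeds the
supremum over all outcomes of `K_r`, then `Pr(K_r = n) = 0` and, for every
state `s` with `Pr(S_{n-1} = s) > 0`,
`Pr(S_n = s) / Pr(S_{n-1} = s) = Σ_{j=1}^n Pr(J = j | f(A_{n,-j}) = s)`,
where `J` is the least index `j` with `f(A_{n,-j}) = f(A_n)`.
-/

theorem Aerase_eq_Afull_removeNth {H : Type*} {m : ℕ} (j : Fin (m + 1)) (ω : Fin (m + 1) → H) :
    Aerase j ω = Afull (fun k => ω (j.succAbove k)) := by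
  ext x
  simp only [Aerase, Afull, Finset.mem_image, Finset.mem_erase, Finset.mem_univ, and_true,
    true_and]
  constructor
  · rintro ⟨a, ha, rfl⟩
    obtain ⟨k, rfl⟩ := Fin.exists_succAbove_eq ha
    exact ⟨k, rfl⟩
  · rintro ⟨k, rfl⟩
    exact ⟨_, Fin.succAbove_ne j k, rfl⟩

theorem streamP_Aerase {H : Type*} [MeasurableSpace H] [MeasurableSingletonClass H] [Countable H]
    {Ω : Type*} (μ : Measure H) [IsProbabilityMeasure μ] (f : Finset H → Ω) {m : ℕ}
    (j : Fin (m + 1)) (s : Ω) :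
    (streamP μ (m + 1)) {ω | f (Aerase j ω) = s} = (streamP μ m) {ω | f (Afull ω) = s} := by
  have h1 := measurePreserving_piFinSuccAbove (fun _ : Fin (m + 1) => μ) j
  have h2 := (measurePreserving_snd (μ := μ) (ν := Measure.pi fun _ : Fin m => μ)).comp h1
  have h3 := h2.measure_preimage (s := {ω | f (Afull ω) = s})
    (MeasurableSet.of_discrete).nullMeasurableSet
  unfold streamP
  rw [← h3]
  congr 1
  ext ω
  simp only [Set.mem_setOf_eq, Aerase_eq_Afull_removeNth]
  rfl

theorem sketch_state_ratio_eq_sum_cond_prob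
    {H : Type*} [MeasurableSpace H] [MeasurableSingletonClass H] [Countable H]
    {Ω : Type*} [Fintype Ω]
    (μ : Measure H) [IsProbabilityMeasure μ]
    (f : Finset H → Ω) (n : ℕ) (hn : 1 ≤ n)
    (hK : ∀ ω : Fin n → H, (Kset f ω).card < n)
    (s : Ω)
    (hpos : 0 < ((streamP μ (n - 1)) {ω | f (Afull ω) = s}).toReal) :
    ((streamP μ n) {ω | (Kset f ω).card = n}).toReal = 0 ∧
      ((streamP μ n) {ω | f (Afull ω) = s}).toReal /
          ((streamP μ (n - 1)) {ω | f (Afull ω) = s}).toReal =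
        ∑ j : Fin n,
          ((streamP μ n) {ω | (f (Aerase j ω) = f (Afull ω) ∧
              ∀ i, i < j → f (Aerase i ω) ≠ f (Afull ω)) ∧ f (Aerase j ω) = s}).toReal /
            ((streamP μ n) {ω | f (Aerase j ω) = s}).toReal := by
  obtain ⟨m, rfl⟩ : ∃ m, n = m + 1 := ⟨n - 1, by omega⟩
  have hPn : IsProbabilityMeasure (streamP μ (m + 1)) := by unfold streamP; infer_instance
  refine ⟨?_, ?_⟩
  · have : {ω : Fin (m + 1) → H | (Kset f ω).card = m + 1} = ∅ := by
      ext ω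
      simpa using (hK ω).ne
    rw [this]; simp
  · simp only [streamP_Aerase, Nat.add_sub_cancel]
    rw [← Finset.sum_div]
    congr 1
    have hU : {ω : Fin (m + 1) → H | f (Afull ω) = s} =
        ⋃ j ∈ (Finset.univ : Finset (Fin (m + 1))), {ω | (f (Aerase j ω) = f (Afull ω) ∧
              ∀ i, i < j → f (Aerase i ω) ≠ f (Afull ω)) ∧ f (Aerase j ω) = s} := by
      ext ω
      simp only [Set.mem_setOf_eq, Set.mem_iUnion, Finset.mem_univ, exists_prop, true_and]
      constructor
      · intro h
        have hex : ∃ j, f (Aerase j ω) = f (Afull ω) := by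
          by_contra hne
          push Not at hne
          have := hK ω
          rw [Kset, Finset.filter_true_of_mem (fun i _ => hne i)] at this
          simp at this
        obtain ⟨j, hj, hmin⟩ := WellFounded.has_min (wellFounded_lt (α := Fin (m + 1)))
          {j | f (Aerase j ω) = f (Afull ω)} hex
        exact ⟨j, ⟨hj, fun i hi he => hmin i he hi⟩, hj.trans h⟩
      · rintro ⟨j, ⟨h1, -⟩, h2⟩
        exact h1.symm.trans h2
    have hd : Set.PairwiseDisjoint (↑(Finset.univ : Finset (Fin (m + 1))))
        (fun j => {ω : Fin (m + 1) → H | (f (Aerase j ω) = f (Afull ω) ∧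
              ∀ i, i < j → f (Aerase i ω) ≠ f (Afull ω)) ∧ f (Aerase j ω) = s}) := by
      intro a _ b _ hab
      refine Set.disjoint_left.2 ?_
      rintro ω ⟨⟨ha, ha'⟩, -⟩ ⟨⟨hb, hb'⟩, -⟩
      rcases lt_or_gt_of_ne hab with h | h
      · exact hb' a h ha
      · exact ha' b h hb
    rw [hU, measure_biUnion_finset hd (fun _ _ => MeasurableSet.of_discrete),
      ENNReal.toReal_sum (fun _ _ => measure_ne_top _ _)]
end

section
/- Suppose there is a finite constant k_max with K_r ≤ k_max for all outcomes and all stream cardinalities, and suppose that for some ε > 0 and for every cardinality n > k_max the differential-privacy lower ratio bound e^{−ε} < Pr(S_n = s)/Pr(S_{n−1} = s) holds for every state s with Pr(S_{n−1} = s) > 0. Then every state s that is attained with positive probability by some S_m satisfies π(s) ≤ 1 − e^{−ε}. -/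
open MeasureTheory

attribute [local instance] Classical.propDecidable

/-!
STATEMENT 4: Suppose `K_r ≤ k_max` for all outcomes and all stream
cardinalities, and suppose that for some `ε > 0` and every cardinality
`n > k_max` the lower differential-privacy ratio bound
`e^{-ε} < Pr(S_n = s)/Pr(S_{n-1} = s)` holds for every state `s` with
`Pr(S_{n-1} = s) > 0`. Then every state `s` attained with positive
probability by some `S_m` (for a stream of `m ≥ 1` items) satisfies
`π(s) ≤ 1 - e^{-ε}`.
-/


lemma aux_meas {X : Type*} [MeasurableSpace X] [MeasurableSingletonClass X] [Countable X]
    (s : Set X) : MeasurableSet s := s.to_countable.measurableSet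

lemma aux_full {H : Type*} {n : ℕ} (i : Fin (n + 1)) (ω : Fin (n + 1) → H) :
    Afull ω = insert (ω i) (Afull (i.removeNth ω)) := by
  ext x
  simp only [Afull, Finset.mem_image, Finset.mem_univ, true_and, Finset.mem_insert,
    Fin.removeNth, Fin.exists_iff_succAbove i, eq_comm]

lemma aux_erase {H : Type*} {n : ℕ} (i : Fin (n + 1)) (ω : Fin (n + 1) → H) :
    Aerase i ω = Afull (i.removeNth ω) := by
  ext x
  simp [Aerase, Afull, Finset.mem_image, Fin.removeNth, Fin.exists_iff_succAbove i]

lemma aux_step {H : Type*} [MeasurableSpace H] [MeasurableSingletonClass H] [Countable H]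
    {Ω : Type*} (μ : Measure H) [IsProbabilityMeasure μ]
    (f : Finset H → Ω) (c : ENNReal) (s : Ω)
    (hc : ∀ A : Finset H, f A = s → μ {y | f (insert y A) = s} = c) (n : ℕ) (i : Fin (n + 1)) :
    streamP μ (n + 1) {ω | f (Afull ω) = s ∧ f (Aerase i ω) = s} =
      c * streamP μ n {ω | f (Afull ω) = s} := by
  have hmp := measurePreserving_piFinSuccAbove (fun _ : Fin (n + 1) => μ) i
  have hset : {ω : Fin (n + 1) → H | f (Afull ω) = s ∧ f (Aerase i ω) = s} =
      (MeasurableEquiv.piFinSuccAbove (fun _ : Fin (n + 1) => H) i) ⁻¹'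
        {p : H × (Fin n → H) | f (insert p.1 (Afull p.2)) = s ∧ f (Afull p.2) = s} := by
    ext ω
    simp only [Set.mem_setOf_eq, Set.mem_preimage, aux_full i, aux_erase i]
    rfl
  unfold streamP
  rw [hset, hmp.measure_preimage (aux_meas _).nullMeasurableSet,
    Measure.prod_apply_symm (aux_meas _)]
  rw [← lintegral_indicator_const (aux_meas _)]
  apply lintegral_congr
  intro ω
  by_cases h : f (Afull ω) = s
  · simp [Set.preimage, h, hc _ h]
  · simp [Set.preimage, h]

lemma aux_sum {H : Type*} [MeasurableSpace H] [MeasurableSingletonClass H] [Countable H]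
    {Ω : Type*} (μ : Measure H) [IsProbabilityMeasure μ]
    (f : Finset H → Ω) (kmax : ℕ) (s : Ω) (n : ℕ)
    (hK : ∀ (ω : Fin n → H), (Kset f ω).card ≤ kmax) :
    ((n - kmax : ℕ) : ENNReal) * streamP μ n {ω | f (Afull ω) = s} ≤
      ∑ i : Fin n, streamP μ n {ω | f (Afull ω) = s ∧ f (Aerase i ω) = s} := by
  have h1 : ∀ i : Fin n, streamP μ n {ω | f (Afull ω) = s ∧ f (Aerase i ω) = s} =
      ∫⁻ ω, Set.indicator {ω | f (Afull ω) = s ∧ f (Aerase i ω) = s} 1 ω ∂(streamP μ n) :=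
    fun i => (lintegral_indicator_one (aux_meas _)).symm
  simp_rw [h1]
  rw [← lintegral_finset_sum _ (fun i _ => measurable_one.indicator (aux_meas _)),
    ← lintegral_indicator_const (aux_meas _)]
  apply lintegral_mono
  intro ω
  by_cases h : f (Afull ω) = s
  · have hcard := hK ω
    have hadd := Finset.card_filter_add_card_filter_not (s := (Finset.univ : Finset (Fin n)))
      (fun i => f (Aerase i ω) ≠ f (Afull ω))
    simp only [Kset] at hcard
    simp only [Finset.card_univ, Fintype.card_fin, not_not] at hadd
    rw [h] at hadd hcard
    simp only [Set.indicator_apply, Set.mem_setOf_eq, h, true_and, if_true, Pi.one_apply,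
      Finset.sum_boole]
    exact_mod_cast (by omega)
  · simp [h]

lemma aux_pos {H : Type*} [MeasurableSpace H] [MeasurableSingletonClass H] [Countable H]
    {Ω : Type*} (μ : Measure H) [IsProbabilityMeasure μ]
    (f : Finset H → Ω) (s : Ω) (m : ℕ) (hm : 1 ≤ m)
    (h : streamP μ m {ω | f (Afull ω) = s} ≠ 0) :
    streamP μ (m + 1) {ω | f (Afull ω) = s} ≠ 0 := by
  obtain ⟨ω, hω, hpos⟩ : ∃ ω ∈ {ω : Fin m → H | f (Afull ω) = s}, streamP μ m {ω} ≠ 0 := by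
    by_contra! hcon
    apply h
    rw [← Set.biUnion_of_singleton {ω : Fin m → H | f (Afull ω) = s}]
    exact (measure_biUnion_null_iff (Set.to_countable _)).2 hcon
  intro h0
  let i0 : Fin m := ⟨0, hm⟩
  let ω' : Fin (m + 1) → H := Fin.cons (ω i0) ω
  have hA : Afull ω' = Afull ω := by
    ext x
    simp only [Afull, Finset.mem_image, Finset.mem_univ, true_and, Fin.exists_fin_succ, ω',
      Fin.cons_zero, Fin.cons_succ]
    exact ⟨fun h => h.elim (fun h => ⟨_, h⟩) id, Or.inr⟩
  have h1 : streamP μ (m + 1) {ω'} = 0 :=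
    measure_mono_null (by
      intro x hx
      rw [Set.mem_singleton_iff] at hx
      subst hx
      simpa [hA] using hω) h0
  unfold streamP at h1 hpos
  rw [Measure.pi_singleton] at h1 hpos
  rw [Fin.prod_univ_succ] at h1
  simp only [ω', Fin.cons_zero, Fin.cons_succ] at h1
  rcases mul_eq_zero.1 h1 with h2 | h2
  · exact hpos (Finset.prod_eq_zero (Finset.mem_univ i0) h2)
  · exact hpos h2

theorem sampling_prob_le_of_dp
    {H : Type*} [MeasurableSpace H] [MeasurableSingletonClass H] [Countable H]
    {Ω : Type*} [Fintype Ω]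
    (μ : Measure H) [IsProbabilityMeasure μ]
    (f : Finset H → Ω) (π : Ω → ℝ)
    (hπ01 : ∀ t : Ω, π t ∈ Set.Icc (0 : ℝ) 1)
    (hπ : ∀ A : Finset H, (μ {y | f (insert y A) ≠ f A}).toReal = π (f A))
    (ε : ℝ) (hε : 0 < ε) (kmax : ℕ)
    (hK : ∀ (m : ℕ) (ω : Fin m → H), (Kset f ω).card ≤ kmax)
    (hDP : ∀ n : ℕ, kmax < n → ∀ s : Ω,
      0 < ((streamP μ (n - 1)) {ω | f (Afull ω) = s}).toReal →
      Real.exp (-ε) <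
        ((streamP μ n) {ω | f (Afull ω) = s}).toReal /
          ((streamP μ (n - 1)) {ω | f (Afull ω) = s}).toReal) :
    ∀ s : Ω,
      (∃ m : ℕ, 1 ≤ m ∧ 0 < ((streamP μ m) {ω | f (Afull ω) = s}).toReal) →
      π s ≤ 1 - Real.exp (-ε) := by
  rintro s ⟨m, hm, hpos⟩
  have : ∀ n, IsProbabilityMeasure (streamP μ n) := fun n => by unfold streamP; infer_instance
  have hP : ∀ n, m ≤ n → streamP μ n {ω | f (Afull ω) = s} ≠ 0 := by
    intro n hn
    induction n, hn using Nat.le_induction with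
    | base => exact (ENNReal.toReal_pos_iff.1 hpos).1.ne'
    | succ n hn ih => exact aux_pos μ f s n (hm.trans hn) ih
  have hc : ∀ A : Finset H, f A = s →
      μ {y | f (insert y A) = s} = ENNReal.ofReal (1 - π s) := by
    intro A hA
    have h1 := hπ A
    have h2 : {y | f (insert y A) = s} = {y | f (insert y A) ≠ f A}ᶜ := by
      ext y; simp [hA]
    rw [h2, prob_compl_eq_one_sub (aux_meas _), ← hA, ← h1,
      ENNReal.ofReal_sub _ ENNReal.toReal_nonneg, ENNReal.ofReal_toReal (measure_ne_top _ _),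
      ENNReal.ofReal_one]
  have key : ∀ n : ℕ, m ≤ n → kmax ≤ n →
      Real.exp (-ε) * ((n : ℝ) + 1 - kmax) ≤ (n + 1) * (1 - π s) := by
    intro n hn hk
    have hp : 0 < (streamP μ n {ω | f (Afull ω) = s}).toReal :=
      ENNReal.toReal_pos (hP n hn) (measure_ne_top _ _)
    have hd := hDP (n + 1) (by omega) s
    rw [Nat.add_sub_cancel] at hd
    have hd := hd hp
    rw [lt_div_iff₀ hp] at hd
    have hs := aux_sum μ f kmax s (n + 1) (hK _)
    simp_rw [aux_step μ f _ s hc n] at hs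
    rw [Finset.sum_const, Finset.card_univ, Fintype.card_fin, nsmul_eq_mul] at hs
    have hs := ENNReal.toReal_mono (by finiteness) hs
    simp only [ENNReal.toReal_mul, ENNReal.toReal_natCast,
      ENNReal.toReal_ofReal (sub_nonneg.2 (hπ01 s).2)] at hs
    rw [Nat.cast_sub (by omega)] at hs
    push_cast at hs
    have hk' : (0 : ℝ) ≤ (n : ℝ) + 1 - kmax := by
      have : (kmax : ℝ) ≤ n := by exact_mod_cast hk
      linarith
    have := mul_le_mul_of_nonneg_left hd.le hk'
    refine le_of_mul_le_mul_right ?_ hp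
    linarith
  by_contra! hcon
  obtain ⟨N, hN⟩ := exists_nat_gt (Real.exp (-ε) * kmax / (Real.exp (-ε) - (1 - π s)))
  have hδ : 0 < Real.exp (-ε) - (1 - π s) := by linarith
  rw [div_lt_iff₀ hδ] at hN
  have h := key (N + m + kmax) (by omega) (by omega)
  push_cast at h
  have h3 : (0 : ℝ) ≤ ((m : ℝ) + kmax + 1) * (Real.exp (-ε) - (1 - π s)) := by positivity
  nlinarith
end

section
/- Fix ε > 0 and a constant k_max with K_r ≤ k_max for all outcomes. If sup_{s ∈ Ω} π(s) < 1 − e^{−ε} and the number of distinct stream items satisfies n > k_max/(1 − e^{−ε}), then for every state s with Pr(S_{n−1} = s) > 0, e^{−ε} < Pr(S_n = s)/Pr(S_{n−1} = s) < e^{ε}; that is, the sketch is ε-differentially private with respect to the presence or absence of a single distinct item. -/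
open MeasureTheory

attribute [local instance] Classical.propDecidable

/-!
STATEMENT 5: Fix `ε > 0` and a constant `k_max` with `K_r ≤ k_max` for all
outcomes. If `sup_s π(s) < 1 - e^{-ε}` and the number of distinct stream
items satisfies `n > k_max/(1 - e^{-ε})`, then for every state `s` with
`Pr(S_{n-1} = s) > 0`, `e^{-ε} < Pr(S_n = s)/Pr(S_{n-1} = s) < e^ε`;
the sketch is ε-differentially private.
-/

lemma sketch_joint
    {H : Type*} [MeasurableSpace H] [MeasurableSingletonClass H] [Countable H]
    {Ω : Type*} (μ : Measure H) [IsProbabilityMeasure μ]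
    (f : Finset H → Ω) (π : Ω → ℝ)
    (hπ : ∀ A : Finset H, (μ {y | f (insert y A) ≠ f A}).toReal = π (f A))
    (m : ℕ) (s : Ω) (i : Fin (m + 1)) :
    (streamP μ (m + 1)) {ω | f (Aerase i ω) = s ∧ f (Afull ω) = s} =
      ENNReal.ofReal (1 - π s) * (streamP μ m) {ω | f (Afull ω) = s} := by
  have hms : ∀ (k : ℕ) (S : Set (Fin k → H)), MeasurableSet S :=
    fun k S => S.to_countable.measurableSet
  have hmp := measurePreserving_piFinSuccAbove (fun _ : Fin (m + 1) => μ) i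
  set T : Set (H × (Fin m → H)) :=
    {p | f (Afull p.2) = s ∧ f (insert p.1 (Afull p.2)) = s} with hT
  have hTm : MeasurableSet T := T.to_countable.measurableSet
  have hpre : {ω : Fin (m + 1) → H | f (Aerase i ω) = s ∧ f (Afull ω) = s} =
      (MeasurableEquiv.piFinSuccAbove (fun _ : Fin (m + 1) => H) i) ⁻¹' T := by
    ext ω
    have h1 : Aerase i ω = Afull (fun j => ω (i.succAbove j)) := by
      ext x
      simp only [Aerase, Afull, Finset.mem_image, Finset.mem_erase, Finset.mem_univ, and_true,
        true_and]
      constructor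
      · rintro ⟨j, hj, rfl⟩
        obtain ⟨k, rfl⟩ := Fin.exists_succAbove_eq hj
        exact ⟨k, rfl⟩
      · rintro ⟨k, rfl⟩
        exact ⟨_, Fin.succAbove_ne i k, rfl⟩
    have h2 : Afull ω = insert (ω i) (Aerase i ω) := by
      unfold Afull Aerase
      rw [← Finset.image_insert, Finset.insert_erase (Finset.mem_univ i)]
    have h3 : (MeasurableEquiv.piFinSuccAbove (fun _ : Fin (m + 1) => H) i) ω =
      (ω i, fun j => ω (i.succAbove j)) := rfl
    simp only [Set.mem_preimage, h3, hT, Set.mem_setOf_eq, h2, h1]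
  unfold streamP
  rw [hpre, hmp.measure_preimage hTm.nullMeasurableSet, Measure.prod_apply_symm hTm]
  have hint : ∀ v : Fin m → H, μ ((fun x => (x, v)) ⁻¹' T) =
      Set.indicator {ω : Fin m → H | f (Afull ω) = s}
        (fun _ => ENNReal.ofReal (1 - π s)) v := by
    intro v
    by_cases hv : f (Afull v) = s
    · rw [Set.indicator_of_mem (by exact hv)]
      have : ((fun x => (x, v)) ⁻¹' T) = {y | f (insert y (Afull v)) ≠ f (Afull v)}ᶜ := by
        ext y
        simp [hT, hv]
      rw [this, prob_compl_eq_one_sub (Set.to_countable _).measurableSet]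
      have h := hπ (Afull v)
      rw [hv] at h
      rw [hv, ENNReal.ofReal_sub _ (by rw [← h]; exact ENNReal.toReal_nonneg), ← h,
        ENNReal.ofReal_toReal (measure_ne_top _ _), ENNReal.ofReal_one]
    · rw [Set.indicator_of_notMem (by exact hv)]
      have : ((fun x => (x, v)) ⁻¹' T) = ∅ := by
        ext y
        simp [hT, hv]
      rw [this, measure_empty]
  simp_rw [hint]
  rw [lintegral_indicator (hms _ _), lintegral_const, Measure.restrict_apply_univ]

lemma sketch_count
    {H : Type*} [MeasurableSpace H] [MeasurableSingletonClass H] [Countable H]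
    {Ω : Type*} (μ : Measure H)
    (f : Finset H → Ω) (kmax n : ℕ)
    (hK : ∀ ω : Fin n → H, (Kset f ω).card ≤ kmax) (s : Ω) :
    ((n - kmax : ℕ) : ENNReal) * (streamP μ n) {ω | f (Afull ω) = s} ≤
      ∑ i : Fin n, (streamP μ n) {ω | f (Aerase i ω) = s ∧ f (Afull ω) = s} := by
  have hms : ∀ (S : Set (Fin n → H)), MeasurableSet S :=
    fun S => S.to_countable.measurableSet
  have e : ∀ i : Fin n, (streamP μ n) {ω | f (Aerase i ω) = s ∧ f (Afull ω) = s} =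
      ∫⁻ ω, Set.indicator {ω | f (Aerase i ω) = s ∧ f (Afull ω) = s} 1 ω ∂(streamP μ n) :=
    fun i => (lintegral_indicator_one (hms _)).symm
  simp_rw [e]
  rw [← lintegral_finsetSum _ (fun i _ => measurable_one.indicator (hms _)),
    ← lintegral_indicator_const (hms _)]
  refine lintegral_mono fun ω => ?_
  by_cases hω : f (Afull ω) = s
  · rw [Set.indicator_of_mem (by exact hω)]
    have h1 : ∀ i : Fin n, Set.indicator {ω | f (Aerase i ω) = s ∧ f (Afull ω) = s}
        (1 : (Fin n → H) → ENNReal) ω = if i ∈ (Kset f ω)ᶜ then 1 else 0 := by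
      intro i
      simp [Set.indicator_apply, Kset, hω]
    simp_rw [h1]
    rw [Finset.sum_ite_mem, Finset.univ_inter, Finset.sum_const, Finset.card_compl,
      Fintype.card_fin, nsmul_eq_mul, mul_one]
    have := hK ω
    exact_mod_cast (by omega : n - kmax ≤ n - (Kset f ω).card)
  · rw [Set.indicator_of_notMem (by exact hω)]
    exact zero_le

theorem sketch_eps_dp_of_downsampled_and_large_stream
    {H : Type*} [MeasurableSpace H] [MeasurableSingletonClass H] [Countable H]
    {Ω : Type*} [Fintype Ω]
    (μ : Measure H) [IsProbabilityMeasure μ]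
    (f : Finset H → Ω) (π : Ω → ℝ)
    (hπ01 : ∀ t : Ω, π t ∈ Set.Icc (0 : ℝ) 1)
    (hπ : ∀ A : Finset H, (μ {y | f (insert y A) ≠ f A}).toReal = π (f A))
    (ε : ℝ) (hε : 0 < ε) (kmax : ℕ) (n : ℕ)
    (hK : ∀ ω : Fin n → H, (Kset f ω).card ≤ kmax)
    (hsup : ∀ t : Ω, π t < 1 - Real.exp (-ε))
    (hn : (kmax : ℝ) / (1 - Real.exp (-ε)) < (n : ℝ)) :
    ∀ s : Ω, 0 < ((streamP μ (n - 1)) {ω | f (Afull ω) = s}).toReal →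
      Real.exp (-ε) <
          ((streamP μ n) {ω | f (Afull ω) = s}).toReal /
            ((streamP μ (n - 1)) {ω | f (Afull ω) = s}).toReal ∧
        ((streamP μ n) {ω | f (Afull ω) = s}).toReal /
            ((streamP μ (n - 1)) {ω | f (Afull ω) = s}).toReal < Real.exp ε := by
  intro s ha
  have hE1 : Real.exp (-ε) < 1 := by rw [Real.exp_lt_one_iff]; linarith
  have hEpos := Real.exp_pos (-ε)
  have hn' : (kmax : ℝ) < n * (1 - Real.exp (-ε)) := by
    rwa [div_lt_iff₀ (by linarith)] at hn
  obtain ⟨m, rfl⟩ : ∃ m, n = m + 1 := by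
    refine Nat.exists_eq_succ_of_ne_zero ?_
    rintro rfl
    have : (0 : ℝ) ≤ kmax := Nat.cast_nonneg _
    simp at hn'
    linarith
  change 0 < ((streamP μ m) {ω | f (Afull ω) = s}).toReal at ha
  change Real.exp (-ε) < ((streamP μ (m + 1)) {ω | f (Afull ω) = s}).toReal /
      ((streamP μ m) {ω | f (Afull ω) = s}).toReal ∧
    ((streamP μ (m + 1)) {ω | f (Afull ω) = s}).toReal /
      ((streamP μ m) {ω | f (Afull ω) = s}).toReal < Real.exp ε
  have hj := sketch_joint μ f π hπ m s
  have hc := sketch_count μ f kmax (m + 1) hK s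
  haveI : ∀ k, IsProbabilityMeasure (streamP μ k) := fun k => by unfold streamP; infer_instance
  have hlow : ENNReal.ofReal (1 - π s) * (streamP μ m) {ω | f (Afull ω) = s} ≤
      (streamP μ (m + 1)) {ω | f (Afull ω) = s} := by
    rw [← hj 0]
    exact measure_mono fun ω h => h.2
  simp_rw [hj] at hc
  rw [Finset.sum_const, Finset.card_univ, Fintype.card_fin, nsmul_eq_mul] at hc
  have hπs := hsup s
  have hπ0 := (hπ01 s).1
  have hlow' := ENNReal.toReal_mono (measure_ne_top _ _) hlow
  have hc' := ENNReal.toReal_mono (by finiteness) hc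
  rw [ENNReal.toReal_mul, ENNReal.toReal_ofReal (by linarith)] at hlow'
  rw [ENNReal.toReal_mul, ENNReal.toReal_mul, ENNReal.toReal_mul,
    ENNReal.toReal_ofReal (by linarith), ENNReal.toReal_natCast, ENNReal.toReal_natCast] at hc'
  set a := ((streamP μ m) {ω | f (Afull ω) = s}).toReal
  set b := ((streamP μ (m + 1)) {ω | f (Afull ω) = s}).toReal
  set E := Real.exp (-ε)
  have hN : (0 : ℝ) < ((m + 1 : ℕ) : ℝ) := by positivity
  have hk : kmax ≤ m + 1 := by
    have : (kmax : ℝ) < ((m + 1 : ℕ) : ℝ) := by nlinarith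
    exact_mod_cast this.le
  rw [Nat.cast_sub hk] at hc'
  have hab : E * a < b := lt_of_lt_of_le (mul_lt_mul_of_pos_right (by linarith) ha) hlow'
  have hb : 0 < b := lt_trans (mul_pos hEpos ha) hab
  refine ⟨(lt_div_iff₀ ha).2 hab, (div_lt_iff₀ ha).2 ?_⟩
  have h1 : ((m + 1 : ℕ) : ℝ) * (E * b) < ((m + 1 : ℕ) : ℝ) * a := by
    have h2 : ((m + 1 : ℕ) : ℝ) * E * b < (((m + 1 : ℕ) : ℝ) - kmax) * b :=
      mul_lt_mul_of_pos_right (by linarith) hb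
    have h3 : ((m + 1 : ℕ) : ℝ) * ((1 - π s) * a) ≤ ((m + 1 : ℕ) : ℝ) * a :=
      mul_le_mul_of_nonneg_left (by nlinarith) hN.le
    linarith
  have h4 : E * b < a := lt_of_mul_lt_mul_left h1 hN.le
  have h5 : Real.exp ε * E = 1 := by rw [← Real.exp_add]; simp
  calc b = Real.exp ε * (E * b) := by rw [← mul_assoc, h5, one_mul]
    _ < Real.exp ε * a := mul_lt_mul_of_pos_left h4 (Real.exp_pos _)
end

section
/- Assume the sketch has a cardinality estimator N̂ : Ω → ℝ of the form N̂(s) = Ñ(π(s)) for a strictly decreasing function Ñ : [0,1] → ℝ. Fix ε > 0, π0 := 1 − e^{−ε}, n0 := k_max/(1 − e^{−ε}). Then {s ∈ Ω : π(s) > π0} = {s ∈ Ω : N̂(s) < Ñ(π0)}, and if the number of distinct stream items satisfies n ≥ n0, then for every subset T ⊆ Ω both Pr(S_n ∈ T) ≤ e^{ε} · Pr(S_{n−1} ∈ T) + δ and Pr(S_{n−1} ∈ T) ≤ e^{ε} · Pr(S_n ∈ T) + δ hold, where δ := max( Pr(N̂(S_n) < Ñ(π0)), Pr(N̂(S_{n−1})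 < Ñ(π0)) ). -/
open MeasureTheory

attribute [local instance] Classical.propDecidable

lemma Afull_eq_insert {H : Type*} {m : ℕ} (i : Fin (m+1)) (ω : Fin (m+1) → H) :
    Afull ω = insert (ω i) (Aerase i ω) := by
  ext x
  simp only [Afull, Aerase, Finset.mem_image, Finset.mem_univ, true_and, Finset.mem_insert,
    Finset.mem_erase, and_true]
  constructor
  · rintro ⟨j, rfl⟩
    by_cases h : j = i
    · left; rw [h]
    · right; exact ⟨j, h, rfl⟩
  · rintro (rfl | ⟨j, _, rfl⟩)
    · exact ⟨i, rfl⟩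
    · exact ⟨j, rfl⟩

lemma Aerase_eq_Afull {H : Type*} {m : ℕ} (i : Fin (m+1)) (ω : Fin (m+1) → H) :
    Aerase i ω = Afull (i.removeNth ω) := by
  ext x
  simp only [Afull, Aerase, Finset.mem_image, Finset.mem_univ, true_and,
    Finset.mem_erase, and_true, Fin.removeNth]
  constructor
  · rintro ⟨j, hj, rfl⟩
    obtain ⟨k, rfl⟩ := Fin.exists_succAbove_eq hj
    exact ⟨k, rfl⟩
  · rintro ⟨k, rfl⟩
    exact ⟨_, Fin.succAbove_ne i k, rfl⟩

instance streamP_isProb {H : Type*} [MeasurableSpace H] (μ : Measure H)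
    [IsProbabilityMeasure μ] (n : ℕ) : IsProbabilityMeasure (streamP μ n) := by
  unfold streamP; infer_instance

section
variable {H : Type*} [MeasurableSpace H] [MeasurableSingletonClass H] [Countable H]

lemma streamP_succ (μ : Measure H) [IsProbabilityMeasure μ] {m : ℕ} (i : Fin (m+1))
    (S : Set (H × (Fin m → H))) :
    streamP μ (m+1) {ω | (ω i, i.removeNth ω) ∈ S} = (μ.prod (streamP μ m)) S := by
  have h := measurePreserving_piFinSuccAbove (fun _ : Fin (m+1) => μ) i
  have := h.measure_preimage (s := S) (Set.to_countable S).measurableSet.nullMeasurableSet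
  exact this

lemma streamP_erase (μ : Measure H) [IsProbabilityMeasure μ] {m : ℕ} (i : Fin (m+1))
    {Ω : Type*} (f : Finset H → Ω) (T : Set Ω) :
    streamP μ (m+1) {ω | f (Aerase i ω) ∈ T} = streamP μ m {ω | f (Afull ω) ∈ T} := by
  have := streamP_succ μ i (Set.univ ×ˢ {ω | f (Afull ω) ∈ T})
  rw [Measure.prod_prod, measure_univ, one_mul] at this
  rw [← this]
  congr 1
  ext ω
  simp [Aerase_eq_Afull]

lemma dir_one (μ : Measure H) [IsProbabilityMeasure μ] {m : ℕ}
    {Ω : Type*} (f : Finset H → Ω) (T : Set Ω) (kmax : ℕ)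
    (hK : ∀ ω : Fin (m+1) → H, (Kset f ω).card ≤ kmax) :
    (((m+1 : ℕ) : ℝ) - kmax) * (streamP μ (m+1)).real {ω | f (Afull ω) ∈ T} ≤
      ((m+1 : ℕ) : ℝ) * (streamP μ m).real {ω | f (Afull ω) ∈ T} := by
  set P := streamP μ (m+1) with hP
  have hm : ∀ s : Set (Fin (m+1) → H), MeasurableSet s := fun s => (Set.to_countable s).measurableSet
  let E : Fin (m+1) → Set (Fin (m+1) → H) :=
    fun i => {ω | f (Afull ω) ∈ T ∧ f (Aerase i ω) = f (Afull ω)}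
  have h1 : ∀ i, P.real (E i) ≤ (streamP μ m).real {ω | f (Afull ω) ∈ T} := by
    intro i
    rw [measureReal_def (μ := streamP μ m), ← streamP_erase μ i f T, ← measureReal_def]
    refine measureReal_mono ?_ (measure_ne_top _ _)
    rintro ω ⟨h, h'⟩
    show f (Aerase i ω) ∈ T
    rw [h']; exact h
  have h2 : ∑ i, P.real (E i) ≤ ((m+1 : ℕ) : ℝ) * (streamP μ m).real {ω | f (Afull ω) ∈ T} := by
    refine (Finset.sum_le_sum fun i _ => h1 i).trans ?_
    simp
  refine le_trans ?_ h2
  have hint : ∀ s : Set (Fin (m+1) → H), Integrable (s.indicator (fun _ => (1:ℝ))) P :=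
    fun s => (integrable_const 1).indicator (hm s)
  have hreal : ∀ s : Set (Fin (m+1) → H), P.real s = ∫ ω, s.indicator (fun _ => (1:ℝ)) ω ∂P := by
    intro s
    rw [integral_indicator (hm s)]; simp
  simp_rw [hreal]
  rw [← integral_finsetSum _ (fun i _ => hint _), ← integral_const_mul]
  apply integral_mono ((hint _).const_mul _) (integrable_finsetSum _ fun i _ => hint _)
  intro ω
  by_cases hω : f (Afull ω) ∈ T
  · have e1 : ∑ i, (E i).indicator (fun _ => (1:ℝ)) ω
        = ((Finset.univ.filter fun i => ¬ (f (Aerase i ω) ≠ f (Afull ω))).card : ℝ) := by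
      rw [Finset.card_filter]
      push_cast
      refine Finset.sum_congr rfl fun i _ => ?_
      simp [E, Set.indicator, hω]
    have e2 := Finset.card_filter_add_card_filter_not (s := (Finset.univ : Finset (Fin (m+1))))
      (fun i => f (Aerase i ω) ≠ f (Afull ω))
    have e3 : (Finset.univ.filter fun i => f (Aerase i ω) ≠ f (Afull ω)).card ≤ kmax := hK ω
    rw [Finset.card_univ, Fintype.card_fin] at e2
    have e4 : (m+1 : ℕ) ≤ kmax + (Finset.univ.filter fun i => ¬ (f (Aerase i ω) ≠ f (Afull ω))).card := by
      omega
    have e5 : ((m+1 : ℕ) : ℝ) ≤ kmax + ((Finset.univ.filter fun i => ¬ (f (Aerase i ω) ≠ f (Afull ω))).card : ℝ) := by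
      exact_mod_cast e4
    show _ * _ ≤ ∑ i, (E i).indicator (fun _ => (1:ℝ)) ω
    rw [e1, Set.indicator_of_mem (by exact hω)]
    linarith
  · show _ * _ ≤ ∑ i, (E i).indicator (fun _ => (1:ℝ)) ω
    rw [Set.indicator_of_notMem (by exact hω), mul_zero]
    exact Finset.sum_nonneg fun i _ => Set.indicator_nonneg (fun _ _ => zero_le_one) _

lemma dir_two (μ : Measure H) [IsProbabilityMeasure μ] {m : ℕ}
    {Ω : Type*} (f : Finset H → Ω) (T : Set Ω) (π : Ω → ℝ)
    (hπ : ∀ A : Finset H, (μ {y | f (insert y A) ≠ f A}).toReal = π (f A)) (c : ℝ) :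
    c * (streamP μ m).real {ω | f (Afull ω) ∈ T ∧ π (f (Afull ω)) ≤ 1 - c} ≤
      (streamP μ (m+1)).real {ω | f (Afull ω) ∈ T} := by
  rcases le_or_gt c 0 with hc | hc
  · exact (mul_nonpos_of_nonpos_of_nonneg hc measureReal_nonneg).trans measureReal_nonneg
  have hm : ∀ s : Set (Fin m → H), MeasurableSet s := fun s => (Set.to_countable s).measurableSet
  set G : Set (Fin m → H) := {ω | f (Afull ω) ∈ T ∧ π (f (Afull ω)) ≤ 1 - c} with hG
  let S : Set (H × (Fin m → H)) := {p | p.2 ∈ G ∧ f (insert p.1 (Afull p.2)) = f (Afull p.2)}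
  have h1 : (μ.prod (streamP μ m)) S ≤ streamP μ (m+1) {ω | f (Afull ω) ∈ T} := by
    rw [← streamP_succ μ 0 S]
    apply measure_mono
    rintro ω ⟨h, h'⟩
    show f (Afull ω) ∈ T
    rw [Afull_eq_insert 0, Aerase_eq_Afull]
    rw [h']; exact h.1
  have h2 : ENNReal.ofReal c * streamP μ m G ≤ (μ.prod (streamP μ m)) S := by
    rw [Measure.prod_apply_symm (Set.to_countable S).measurableSet,
      ← lintegral_indicator_const (hm G)]
    apply lintegral_mono
    intro ω
    by_cases hω : ω ∈ G
    · show G.indicator _ ω ≤ _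
      rw [Set.indicator_of_mem hω]
      have : ((fun x => (x, ω)) ⁻¹' S) = {y | f (insert y (Afull ω)) ≠ f (Afull ω)}ᶜ := by
        ext y; simp [S, hω]
      show _ ≤ μ ((fun x => (x, ω)) ⁻¹' S)
      rw [this]
      apply ENNReal.ofReal_le_of_le_toReal
      rw [← measureReal_def, probReal_compl_eq_one_sub (Set.to_countable _).measurableSet,
        measureReal_def, hπ]
      linarith [hω.2]
    · show G.indicator _ ω ≤ _
      rw [Set.indicator_of_notMem hω]
      exact zero_le
  have h3 := ENNReal.toReal_mono (measure_ne_top _ _) (h2.trans h1)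
  rwa [ENNReal.toReal_mul, ENNReal.toReal_ofReal hc.le] at h3

end

/-!
STATEMENT 7: Suppose the cardinality estimator has the form `N̂(s) = Ñ(π(s))`
for a strictly decreasing `Ñ : [0,1] → ℝ`. With `π0 := 1 - e^{-ε}` and
`n0 := k_max/(1 - e^{-ε})`:
`{s : π(s) > π0} = {s : N̂(s) < Ñ(π0)}`, and if `n ≥ n0` the sketch is
`(ε, δ)`-DP with `δ := max(Pr(N̂(S_n) < Ñ(π0)), Pr(N̂(S_{n-1}) < Ñ(π0)))`.
-/

theorem sketch_approx_dp_via_estimator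
    {H : Type*} [MeasurableSpace H] [MeasurableSingletonClass H] [Countable H]
    {Ω : Type*} [Fintype Ω]
    (μ : Measure H) [IsProbabilityMeasure μ]
    (f : Finset H → Ω) (π : Ω → ℝ)
    (hπ01 : ∀ t : Ω, π t ∈ Set.Icc (0 : ℝ) 1)
    (hπ : ∀ A : Finset H, (μ {y | f (insert y A) ≠ f A}).toReal = π (f A))
    (Ntil : ℝ → ℝ) (hNtil : StrictAntiOn Ntil (Set.Icc (0 : ℝ) 1))
    (ε : ℝ) (hε : 0 < ε) (kmax : ℕ) (n : ℕ)
    (hK : ∀ ω : Fin n → H, (Kset f ω).card ≤ kmax)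
    (hn : (kmax : ℝ) / (1 - Real.exp (-ε)) ≤ (n : ℝ)) :
    {s : Ω | 1 - Real.exp (-ε) < π s} =
        {s : Ω | Ntil (π s) < Ntil (1 - Real.exp (-ε))} ∧
      ∀ T : Set Ω,
        ((streamP μ n) {ω | f (Afull ω) ∈ T}).toReal ≤
            Real.exp ε * ((streamP μ (n - 1)) {ω | f (Afull ω) ∈ T}).toReal +
              max ((streamP μ n)
                  {ω | Ntil (π (f (Afull ω))) < Ntil (1 - Real.exp (-ε))}).toReal
                ((streamP μ (n - 1))
                  {ω | Ntil (π (f (Afull ω))) < Ntil (1 - Real.exp (-ε))}).toReal ∧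
          ((streamP μ (n - 1)) {ω | f (Afull ω) ∈ T}).toReal ≤
            Real.exp ε * ((streamP μ n) {ω | f (Afull ω) ∈ T}).toReal +
              max ((streamP μ n)
                  {ω | Ntil (π (f (Afull ω))) < Ntil (1 - Real.exp (-ε))}).toReal
                ((streamP μ (n - 1))
                  {ω | Ntil (π (f (Afull ω))) < Ntil (1 - Real.exp (-ε))}).toReal := by
  have he1 : Real.exp (-ε) < 1 := by rw [← Real.exp_zero]; exact Real.exp_lt_exp.2 (by linarith)
  have he0 : 0 < Real.exp (-ε) := Real.exp_pos _
  have hee : Real.exp ε * Real.exp (-ε) = 1 := by rw [← Real.exp_add]; simp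
  have hE1 : 1 ≤ Real.exp ε := Real.one_le_exp hε.le
  have hiff : ∀ s, Ntil (π s) < Ntil (1 - Real.exp (-ε)) ↔ 1 - Real.exp (-ε) < π s := fun s =>
    hNtil.lt_iff_gt (hπ01 s) ⟨by linarith, by linarith⟩
  refine ⟨by ext s; exact (hiff s).symm, fun T => ?_⟩
  simp_rw [hiff, ← measureReal_def]
  rcases n with _ | m
  · have h0 : 0 ≤ (streamP μ 0).real {ω | f (Afull ω) ∈ T} := measureReal_nonneg
    have hd : 0 ≤ (streamP μ 0).real {ω | 1 - Real.exp (-ε) < π (f (Afull ω))} := measureReal_nonneg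
    simp only [max_self]
    constructor <;> nlinarith
  have d1 := dir_one μ f T kmax hK
  have d2 := dir_two (m := m) μ f T π hπ (Real.exp (-ε))
  rw [div_le_iff₀ (by linarith)] at hn
  set N : ℝ := ((m + 1 : ℕ) : ℝ) with hN
  have hNpos : 0 < N := by rw [hN]; positivity
  have d3 : (streamP μ m).real {ω | f (Afull ω) ∈ T} ≤
      (streamP μ m).real {ω | f (Afull ω) ∈ T ∧ π (f (Afull ω)) ≤ 1 - Real.exp (-ε)} +
      (streamP μ m).real {ω | 1 - Real.exp (-ε) < π (f (Afull ω))} := by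
    refine (measureReal_mono ?_).trans (measureReal_union_le _ _)
    intro ω hω
    rcases le_or_gt (π (f (Afull ω))) (1 - Real.exp (-ε)) with h | h
    · exact Or.inl ⟨hω, h⟩
    · exact Or.inr h
  have hq : 0 ≤ (streamP μ (m+1)).real {ω | f (Afull ω) ∈ T} := measureReal_nonneg
  have hd1 : 0 ≤ (streamP μ m).real {ω | 1 - Real.exp (-ε) < π (f (Afull ω))} := measureReal_nonneg
  have hmax := le_max_right ((streamP μ (m+1)).real {ω | 1 - Real.exp (-ε) < π (f (Afull ω))})
    ((streamP μ m).real {ω | 1 - Real.exp (-ε) < π (f (Afull ω))})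
  set δ := max ((streamP μ (m+1)).real {ω | 1 - Real.exp (-ε) < π (f (Afull ω))})
    ((streamP μ m).real {ω | 1 - Real.exp (-ε) < π (f (Afull ω))})
  set q := (streamP μ (m+1)).real {ω | f (Afull ω) ∈ T}
  set p := (streamP μ m).real {ω | f (Afull ω) ∈ T}
  set g := (streamP μ m).real {ω | f (Afull ω) ∈ T ∧ π (f (Afull ω)) ≤ 1 - Real.exp (-ε)}
  have key : ∀ x y : ℝ, Real.exp (-ε) * x ≤ y → x ≤ Real.exp ε * y := by
    intro x y h
    have := mul_le_mul_of_nonneg_left h (Real.exp_pos ε).le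
    rwa [← mul_assoc, hee, one_mul] at this
  change q ≤ Real.exp ε * p + δ ∧ p ≤ Real.exp ε * q + δ
  constructor
  · have : Real.exp (-ε) * q ≤ p := by
      have h1 : N * Real.exp (-ε) * q ≤ (N - kmax) * q :=
        mul_le_mul_of_nonneg_right (by linarith) hq
      have h2 : N * (Real.exp (-ε) * q) ≤ N * p := by linarith
      exact le_of_mul_le_mul_left h2 hNpos
    linarith [key _ _ this]
  · linarith [key _ _ d2]
end

section
/- Fix ε > 0 and let π0 := 1 − e^{−ε}. Define the downsampled sketch on the hash space H' := [0,1] × H with law Uniform[0,1] ⊗ μ by f'(A) := f({y ∈ H : ∃ u < π0 with (u, y) ∈ A}) for finite A ⊆ H'. Then f' is again a hash-based order-invariant sketch, its state-dependent sampling probability satisfies π'(f'(A)) = π0 · π(f(A)) ≤ π0 for every reachable state, and at most k_max items can change f' by removal. Consequently, for every stream of n > n0 := k_max/(1 − e^{−ε}) distinct items, the downsampled sketch S'_n := f'({(U_1, X_1), …, (U_n, X_n)}) with (U_i, X_i) i.i.d. Uniform[0,1] ⊗ μ satisfies e^{−ε} ≤ Pr(S'_n = s)/Pr(S'_{n−1}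 = s) ≤ e^{ε} for every state s with positive denominator; that is, the procedure DPSketchLargeSet is ε-differentially private. -/
open MeasureTheory

attribute [local instance] Classical.propDecidable

/-- The downsampled sketch: an item with augmented hash `(u, y)` is fed to the
base sketch `f` iff `u < π0`. -/
noncomputable def downsample {H : Type*} {Ω : Type*} (f : Finset H → Ω) (π0 : ℝ) :
    Finset (ℝ × H) → Ω :=
  fun A => f ((A.filter fun p => p.1 < π0).image Prod.snd)

/-- The law of an augmented hash: an independent uniform value in `[0,1]`
paired with a base hash of law `μ`. -/
noncomputable def augLaw {H : Type*} [MeasurableSpace H] (μ : Measure H) :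
    Measure (ℝ × H) :=
  (MeasureTheory.volume.restrict (Set.Icc (0 : ℝ) 1)).prod μ

open scoped ENNReal

/-- The part of an augmented hash the downsampled sketch depends on. -/
noncomputable def keyMap {H : Type*} (π0 : ℝ) (p : ℝ × H) : Bool × H :=
  (decide (p.1 < π0), p.2)

lemma measurable_keyMap {H : Type*} [MeasurableSpace H] (π0 : ℝ) :
    Measurable (keyMap (H := H) π0) := by
  unfold keyMap
  refine Measurable.prodMk ?_ measurable_snd
  refine measurable_to_bool ?_
  have : (fun p : ℝ × H => decide (p.1 < π0)) ⁻¹' {true} = Prod.fst ⁻¹' (Set.Iio π0) := by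
    ext p; simp
  rw [this]
  exact measurable_fst measurableSet_Iio

/-- Retained base hashes. -/
noncomputable def kept {H : Type*} (π0 : ℝ) (A : Finset (ℝ × H)) : Finset H :=
  (A.filter fun p => p.1 < π0).image Prod.snd

lemma downsample_eq {H Ω : Type*} (f : Finset H → Ω) (π0 : ℝ) (A : Finset (ℝ × H)) :
    downsample f π0 A = f (kept π0 A) := rfl

lemma mem_kept {H : Type*} {π0 : ℝ} {A : Finset (ℝ × H)} {y : H} :
    y ∈ kept π0 A ↔ ∃ p ∈ A, p.1 < π0 ∧ p.2 = y := by
  simp only [kept, Finset.mem_image, Finset.mem_filter, and_assoc]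

lemma kept_insert_lt {H : Type*} {π0 : ℝ} {A : Finset (ℝ × H)} {p : ℝ × H} (h : p.1 < π0) :
    kept π0 (insert p A) = insert p.2 (kept π0 A) := by
  simp [kept, Finset.filter_insert, h]

lemma kept_insert_ge {H : Type*} {π0 : ℝ} {A : Finset (ℝ × H)} {p : ℝ × H} (h : ¬ p.1 < π0) :
    kept π0 (insert p A) = kept π0 A := by
  simp [kept, Finset.filter_insert, h]

lemma measurable_stream {H Ω : Type*} [MeasurableSpace H] [MeasurableSingletonClass H]
    [Countable H] (f : Finset H → Ω) (π0 : ℝ) (n : ℕ) (S : Finset (Fin n)) (s : Ω) :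
    MeasurableSet {ω : Fin n → ℝ × H | downsample f π0 (S.image ω) = s} := by
  have hq : Measurable (fun (ω : Fin n → ℝ × H) i => keyMap π0 (ω i)) :=
    measurable_pi_lambda _ fun i => (measurable_keyMap π0).comp (measurable_pi_apply i)
  have : {ω : Fin n → ℝ × H | downsample f π0 (S.image ω) = s} =
      (fun (ω : Fin n → ℝ × H) i => keyMap π0 (ω i)) ⁻¹'
        {v | f ((S.filter fun i => (v i).1 = true).image fun i => (v i).2) = s} := by
    ext ω
    simp only [Set.mem_setOf_eq, Set.mem_preimage, downsample_eq]
    have : kept π0 (S.image ω) = (S.filter fun i => (keyMap π0 (ω i)).1 = true).image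
        fun i => (keyMap π0 (ω i)).2 := by
      ext y
      simp [mem_kept, keyMap, and_assoc]
    rw [this]
  rw [this]
  exact hq (Set.to_countable _).measurableSet

lemma augLaw_changed {H Ω : Type*} [MeasurableSpace H] (μ : Measure H) [IsProbabilityMeasure μ]
    (f : Finset H → Ω) (π0 : ℝ) (h0 : 0 ≤ π0) (h1 : π0 ≤ 1) (A : Finset (ℝ × H)) :
    augLaw μ {p | downsample f π0 (insert p A) ≠ downsample f π0 A} =
      ENNReal.ofReal π0 * μ {y | f (insert y (kept π0 A)) ≠ f (kept π0 A)} := by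
  have : {p | downsample f π0 (insert p A) ≠ downsample f π0 A} =
      Set.Iio π0 ×ˢ {y | f (insert y (kept π0 A)) ≠ f (kept π0 A)} := by
    ext p
    by_cases h : p.1 < π0
    · simp [downsample_eq, kept_insert_lt h, h]
    · simp only [Set.mem_setOf_eq, downsample_eq, kept_insert_ge h, Set.mem_prod, Set.mem_Iio, h,
        false_and, ne_eq, not_true_eq_false]
  rw [this, augLaw, Measure.prod_prod, Measure.restrict_apply measurableSet_Iio]
  have : Set.Iio π0 ∩ Set.Icc 0 1 = Set.Ico 0 π0 := by
    ext x; simp only [Set.mem_inter_iff, Set.mem_Iio, Set.mem_Icc, Set.mem_Ico]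
    constructor
    · rintro ⟨a, b, c⟩; exact ⟨b, a⟩
    · rintro ⟨a, b⟩; exact ⟨b, a, by linarith⟩
  rw [this]; simp

lemma card_Kset_downsample {H Ω : Type*} (f : Finset H → Ω) (π0 : ℝ) (kmax : ℕ)
    (hK : ∀ (m : ℕ) (ω : Fin m → H), (Kset f ω).card ≤ kmax)
    (m : ℕ) (ω : Fin m → ℝ × H) : (Kset (downsample f π0) ω).card ≤ kmax := by
  set R : Finset (Fin m) := Finset.univ.filter fun i => (ω i).1 < π0 with hR
  have hmem : ∀ i, i ∈ R ↔ (ω i).1 < π0 := by intro i; simp [hR]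
  let e := R.equivFin.symm
  let ω' : Fin R.card → H := fun j => (ω (e j)).2
  have hfull : Afull ω' = kept π0 (Afull ω) := by
    ext y
    simp only [mem_kept, Afull, Finset.mem_image, Finset.mem_univ, true_and, ω']
    constructor
    · rintro ⟨j, hj⟩
      exact ⟨_, ⟨e j, rfl⟩, (hmem _).1 (e j).2, hj⟩
    · rintro ⟨_, ⟨i, rfl⟩, hi, hy⟩
      exact ⟨e.symm ⟨i, (hmem i).2 hi⟩, by simpa using hy⟩
  have herase : ∀ j, Aerase j ω' = kept π0 (Aerase (e j : Fin m) ω) := by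
    intro j
    ext y
    simp only [mem_kept, Aerase, Finset.mem_image, Finset.mem_erase, Finset.mem_univ, and_true, ω']
    constructor
    · rintro ⟨k, hk, hj⟩
      exact ⟨_, ⟨e k, fun h => hk (e.injective (Subtype.ext h)), rfl⟩, (hmem _).1 (e k).2, hj⟩
    · rintro ⟨_, ⟨i, hne, rfl⟩, hi, hy⟩
      refine ⟨e.symm ⟨i, (hmem i).2 hi⟩, fun h => hne ?_, by simpa using hy⟩
      rw [← h]; simp
  have hsub : Kset (downsample f π0) ω ⊆ (Kset f ω').image fun j => (e j : Fin m) := by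
    intro i hi
    rw [Kset, Finset.mem_filter] at hi
    replace hi := hi.2
    simp only [downsample_eq] at hi
    have hiR : i ∈ R := by
      by_contra hn
      apply hi
      congr 1
      ext y
      simp only [mem_kept, Aerase, Afull, Finset.mem_image, Finset.mem_erase, Finset.mem_univ,
        and_true, true_and]
      constructor
      · rintro ⟨p, ⟨k, _, h⟩, h'⟩; exact ⟨p, ⟨k, h⟩, h'⟩
      · rintro ⟨p, ⟨k, rfl⟩, h'⟩
        refine ⟨_, ⟨k, fun h => hn ?_, rfl⟩, h'⟩
        rw [← h]; exact (hmem k).2 h'.1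
    refine Finset.mem_image.2 ⟨e.symm ⟨i, hiR⟩, ?_, by simp⟩
    rw [Kset, Finset.mem_filter]
    refine ⟨Finset.mem_univ _, ?_⟩
    rw [herase, hfull]
    simpa using hi
  exact (Finset.card_le_card hsub).trans (Finset.card_image_le.trans (hK _ _))

lemma stream_step {X Ω : Type*} [MeasurableSpace X] (ν : Measure X) [IsProbabilityMeasure ν]
    (g : Finset X → Ω) (c : Ω → ℝ≥0∞)
    (hc : ∀ A, ν {x | g (insert x A) = g A} = c (g A))
    (hm : ∀ n (S : Finset (Fin n)) (s : Ω), MeasurableSet {ω : Fin n → X | g (S.image ω) = s})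
    (m : ℕ) (i : Fin (m + 1)) (s : Ω) :
    streamP ν (m + 1) {ω | g (Aerase i ω) = s ∧ g (Afull ω) = s} =
      c s * streamP ν m {ω | g (Afull ω) = s} := by
  have hmp := measurePreserving_piFinSuccAbove (fun _ : Fin (m + 1) => ν) i
  have hms : MeasurableSet {ω : Fin (m + 1) → X | g (Aerase i ω) = s ∧ g (Afull ω) = s} :=
    (hm _ _ s).inter (hm _ _ s)
  have hsymm := hmp.symm
  have hmeas := hsymm.measurable hms
  unfold streamP
  rw [← hsymm.measure_preimage hms.nullMeasurableSet, Measure.prod_apply_symm hmeas]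
  have hpt : ∀ w : Fin m → X,
      ν ((fun x => (x, w)) ⁻¹' ((MeasurableEquiv.piFinSuccAbove (fun _ => X) i).symm ⁻¹'
        {ω : Fin (m + 1) → X | g (Aerase i ω) = s ∧ g (Afull ω) = s})) =
      ({w : Fin m → X | g (Afull w) = s}.indicator (fun _ => c s)) w := by
    intro w
    have he : ∀ x, (MeasurableEquiv.piFinSuccAbove (fun _ => X) i).symm (x, w) =
        i.insertNth x w := fun x => rfl
    have h1 : ∀ x, Aerase i (i.insertNth x w : Fin (m + 1) → X) = Afull w := by
      intro x
      ext y
      simp only [Aerase, Afull, Finset.mem_image, Finset.mem_erase, Finset.mem_univ, and_true,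
        true_and]
      constructor
      · rintro ⟨k, hk, h⟩
        obtain ⟨j, rfl⟩ := Fin.exists_succAbove_eq hk
        exact ⟨j, by simpa using h⟩
      · rintro ⟨j, h⟩
        exact ⟨i.succAbove j, Fin.succAbove_ne i j, by simpa using h⟩
    have h2 : ∀ x, Afull (i.insertNth x w : Fin (m + 1) → X) = insert x (Afull w) := by
      intro x
      ext y
      simp only [Afull, Finset.mem_image, Finset.mem_insert, Finset.mem_univ, true_and]
      rw [Fin.exists_iff_succAbove i]
      simp [eq_comm]
    have hset : ((fun x => (x, w)) ⁻¹' ((MeasurableEquiv.piFinSuccAbove (fun _ => X) i).symm ⁻¹'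
        {ω : Fin (m + 1) → X | g (Aerase i ω) = s ∧ g (Afull ω) = s})) =
        {x | g (Afull w) = s ∧ g (insert x (Afull w)) = s} := by
      ext x
      simp only [Set.mem_preimage, he, Set.mem_setOf_eq, h1, h2]
    rw [hset]
    by_cases hs : g (Afull w) = s
    · rw [Set.indicator_of_mem (by exact hs)]
      rw [← hs, ← hc]
      simp
    · rw [Set.indicator_of_notMem (by exact hs)]
      simp [hs]
  simp_rw [hpt]
  exact lintegral_indicator_const (hm _ _ s) _

lemma stream_sum {X Ω : Type*} [MeasurableSpace X] (ν : Measure X) [IsProbabilityMeasure ν]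
    (g : Finset X → Ω) (c : Ω → ℝ≥0∞)
    (hc : ∀ A, ν {x | g (insert x A) = g A} = c (g A))
    (hm : ∀ n (S : Finset (Fin n)) (s : Ω), MeasurableSet {ω : Fin n → X | g (S.image ω) = s})
    (kmax : ℕ) (hK : ∀ (m : ℕ) (ω : Fin m → X), (Kset g ω).card ≤ kmax)
    (m : ℕ) (s : Ω) :
    ((m + 1 - kmax : ℕ) : ℝ≥0∞) * streamP ν (m + 1) {ω | g (Afull ω) = s} ≤
      ((m + 1 : ℕ) : ℝ≥0∞) * (c s * streamP ν m {ω | g (Afull ω) = s}) := by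
  have hE : ∀ i : Fin (m + 1),
      MeasurableSet {ω : Fin (m + 1) → X | g (Aerase i ω) = s ∧ g (Afull ω) = s} :=
    fun i => (hm _ _ s).inter (hm _ _ s)
  calc ((m + 1 - kmax : ℕ) : ℝ≥0∞) * streamP ν (m + 1) {ω | g (Afull ω) = s}
      = ∫⁻ ω, ({ω : Fin (m + 1) → X | g (Afull ω) = s}.indicator
          (fun _ => ((m + 1 - kmax : ℕ) : ℝ≥0∞))) ω ∂(streamP ν (m + 1)) := by
        exact (lintegral_indicator_const (hm _ _ s) _).symm
    _ ≤ ∫⁻ ω, ∑ i, ({ω : Fin (m + 1) → X | g (Aerase i ω) = s ∧ g (Afull ω) = s}.indicator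
          (fun _ => (1 : ℝ≥0∞))) ω ∂(streamP ν (m + 1)) := by
        refine lintegral_mono fun ω => ?_
        by_cases hs : g (Afull ω) = s
        · rw [Set.indicator_of_mem (by exact hs)]
          simp only [Set.indicator_apply, Set.mem_setOf_eq, hs, and_true]
          rw [Finset.sum_boole]
          norm_cast
          have h1 := hK _ ω
          have h2 := Finset.card_filter_add_card_filter_not
            (s := (Finset.univ : Finset (Fin (m + 1)))) (fun i => g (Aerase i ω) = s)
          have h3 : Kset g ω = Finset.univ.filter (fun i => ¬ g (Aerase i ω) = s) := by
            simp only [Kset, hs, ne_eq]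
          rw [← h3, Finset.card_univ, Fintype.card_fin] at h2
          omega
        · rw [Set.indicator_of_notMem (by exact hs)]
          exact zero_le
    _ = ∑ i : Fin (m + 1), c s * streamP ν m {ω | g (Afull ω) = s} := by
        rw [lintegral_finsetSum _ fun i _ => measurable_const.indicator (hE i)]
        refine Finset.sum_congr rfl fun i _ => ?_
        rw [lintegral_indicator_const (hE i), one_mul, stream_step ν g c hc hm]
    _ = _ := by simp

/-!
STATEMENT 8: With `π0 := 1 - e^{-ε}`, the downsampled sketch
`f'(A) := f({y : ∃ u < π0, (u,y) ∈ A})` on the hash space `[0,1] × H` with law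
`Uniform[0,1] ⊗ μ` is again a hash-based order-invariant sketch; its sampling
probability satisfies `π'(f'(A)) = π0 · π(f'(A)) ≤ π0`, at most `k_max` items
can change it by removal, and on streams of `n > k_max/(1 - e^{-ε})` distinct
items it satisfies `e^{-ε} ≤ Pr(S'_n = s)/Pr(S'_{n-1} = s) ≤ e^ε`:
DPSketchLargeSet is ε-differentially private.
-/

theorem downsampled_sketch_eps_dp
    {H : Type*} [MeasurableSpace H] [MeasurableSingletonClass H] [Countable H]
    {Ω : Type*} [Fintype Ω]
    (μ : Measure H) [IsProbabilityMeasure μ]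
    (f : Finset H → Ω) (π : Ω → ℝ)
    (hπ01 : ∀ t : Ω, π t ∈ Set.Icc (0 : ℝ) 1)
    (hπ : ∀ A : Finset H, (μ {y | f (insert y A) ≠ f A}).toReal = π (f A))
    (ε : ℝ) (hε : 0 < ε) (kmax : ℕ)
    (hK : ∀ (m : ℕ) (ω : Fin m → H), (Kset f ω).card ≤ kmax) :
    (∀ A : Finset (ℝ × H),
        ((augLaw μ) {p | downsample f (1 - Real.exp (-ε)) (insert p A) ≠
              downsample f (1 - Real.exp (-ε)) A}).toReal =
            (1 - Real.exp (-ε)) * π (downsample f (1 - Real.exp (-ε)) A) ∧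
          (1 - Real.exp (-ε)) * π (downsample f (1 - Real.exp (-ε)) A) ≤
            1 - Real.exp (-ε)) ∧
      (∀ (m : ℕ) (ω : Fin m → ℝ × H),
        (Kset (downsample f (1 - Real.exp (-ε))) ω).card ≤ kmax) ∧
      ∀ n : ℕ, (kmax : ℝ) / (1 - Real.exp (-ε)) < (n : ℝ) →
        ∀ s : Ω,
          0 < ((streamP (augLaw μ) (n - 1))
              {ω | downsample f (1 - Real.exp (-ε)) (Afull ω) = s}).toReal →
          Real.exp (-ε) ≤
              ((streamP (augLaw μ) n)
                  {ω | downsample f (1 - Real.exp (-ε)) (Afull ω) = s}).toReal /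
                ((streamP (augLaw μ) (n - 1))
                  {ω | downsample f (1 - Real.exp (-ε)) (Afull ω) = s}).toReal ∧
            ((streamP (augLaw μ) n)
                  {ω | downsample f (1 - Real.exp (-ε)) (Afull ω) = s}).toReal /
                ((streamP (augLaw μ) (n - 1))
                  {ω | downsample f (1 - Real.exp (-ε)) (Afull ω) = s}).toReal ≤
              Real.exp ε := by
  set π0 : ℝ := 1 - Real.exp (-ε) with hπ0
  have hexp : 0 < Real.exp (-ε) := Real.exp_pos _
  have hlt : Real.exp (-ε) < 1 := by rw [Real.exp_lt_one_iff]; linarith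
  have h0 : 0 < π0 := by linarith
  have h1 : π0 ≤ 1 := by linarith
  have hch : ∀ A : Finset (ℝ × H),
      ((augLaw μ) {p | downsample f π0 (insert p A) ≠ downsample f π0 A}).toReal =
        π0 * π (downsample f π0 A) := by
    intro A
    rw [augLaw_changed μ f π0 h0.le h1, ENNReal.toReal_mul, ENNReal.toReal_ofReal h0.le, hπ]
    rfl
  have hKd := card_Kset_downsample f π0 kmax hK
  refine ⟨fun A => ⟨hch A, mul_le_of_le_one_right h0.le (hπ01 _).2⟩, hKd, ?_⟩
  intro n hn s hpos
  obtain ⟨m, rfl⟩ : ∃ m, n = m + 1 := by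
    have : (0 : ℝ) < n := lt_of_le_of_lt (by positivity) hn
    exact ⟨n - 1, by have : 0 < n := by exact_mod_cast this
                     omega⟩
  rw [Nat.add_sub_cancel] at hpos ⊢
  have : IsProbabilityMeasure (volume.restrict (Set.Icc (0 : ℝ) 1)) :=
    ⟨by simp⟩
  have : IsProbabilityMeasure (augLaw μ) := by unfold augLaw; infer_instance
  have : ∀ k, IsProbabilityMeasure (streamP (augLaw μ) k) := by
    intro k; unfold streamP; infer_instance
  have hm := measurable_stream f π0
  have hm1 : ∀ (A : Finset (ℝ × H)) (s : Ω),
      MeasurableSet {p | downsample f π0 (insert p A) = s} := by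
    intro A s
    have : {p | downsample f π0 (insert p A) = s} = keyMap π0 ⁻¹'
        {v | f (if v.1 = true then insert v.2 (kept π0 A) else kept π0 A) = s} := by
      ext p
      by_cases h : p.1 < π0
      · simp [downsample_eq, kept_insert_lt h, h, keyMap]
      · simp [downsample_eq, kept_insert_ge h, h, keyMap]
    rw [this]
    exact measurable_keyMap π0 (Set.to_countable _).measurableSet
  let c : Ω → ENNReal := fun t => ENNReal.ofReal (1 - π0 * π t)
  have hcpos : ∀ t, Real.exp (-ε) ≤ 1 - π0 * π t := by
    intro t
    have := mul_le_of_le_one_right h0.le (hπ01 t).2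
    linarith
  have hc : ∀ A, augLaw μ {p | downsample f π0 (insert p A) = downsample f π0 A} =
      c (downsample f π0 A) := by
    intro A
    have hcompl : {p | downsample f π0 (insert p A) ≠ downsample f π0 A} =
      {p | downsample f π0 (insert p A) = downsample f π0 A}ᶜ := rfl
    have h2 := hch A
    rw [hcompl] at h2
    have h3 := probReal_compl_eq_one_sub (μ := augLaw μ) (hm1 A (downsample f π0 A))
    simp only [measureReal_def] at h3
    rw [h3] at h2
    rw [← ENNReal.ofReal_toReal (measure_ne_top (augLaw μ)
      {p | downsample f π0 (insert p A) = downsample f π0 A})]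
    simp only [c]
    congr 1
    linarith
  have hc' : ∀ A : Finset (ℝ × H), augLaw μ {p | downsample f π0
      (@insert _ _ (@Finset.instInsert _ fun a b => Classical.propDecidable (a = b)) p A) =
      downsample f π0 A} = c (downsample f π0 A) := by
    intro A
    convert hc A
  have hm' : ∀ n (S : Finset (Fin n)) (s : Ω), MeasurableSet {ω : Fin n → ℝ × H |
      downsample f π0 (@Finset.image _ _ (fun a b => Classical.propDecidable (a = b)) ω S) = s} := by
    intro n S s
    convert hm n S s
  have hstep := stream_step (augLaw μ) (downsample f π0) c hc' hm' m 0 s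
  have hsum := stream_sum (augLaw μ) (downsample f π0) c hc' hm' kmax hKd m s
  have hle : streamP (augLaw μ) (m + 1) {ω | downsample f π0 (Aerase 0 ω) = s ∧
      downsample f π0 (Afull ω) = s} ≤
      streamP (augLaw μ) (m + 1) {ω | downsample f π0 (Afull ω) = s} :=
    measure_mono fun ω h => h.2
  rw [hstep] at hle
  have hle' := ENNReal.toReal_mono (measure_ne_top _ _) hle
  have hsum' := ENNReal.toReal_mono (by
    refine ENNReal.mul_ne_top (ENNReal.natCast_ne_top _)
      (ENNReal.mul_ne_top ENNReal.ofReal_ne_top (measure_ne_top _ _))) hsum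
  have hcr : (c s).toReal = 1 - π0 * π s := ENNReal.toReal_ofReal (hexp.le.trans (hcpos s))
  simp only [ENNReal.toReal_mul, ENNReal.toReal_natCast, hcr] at hle' hsum'
  generalize (streamP (augLaw μ) m {ω | downsample f π0 (Afull ω) = s}).toReal = P at *
  have hQ : 0 ≤ (streamP (augLaw μ) (m + 1) {ω | downsample f π0 (Afull ω) = s}).toReal :=
    ENNReal.toReal_nonneg
  generalize (streamP (augLaw μ) (m + 1) {ω | downsample f π0 (Afull ω) = s}).toReal = Q at *
  rw [div_lt_iff₀ h0] at hn
  have hmpos : (0 : ℝ) < ((m + 1 : ℕ) : ℝ) := by positivity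
  have hkm : kmax ≤ m + 1 := by
    have : (kmax : ℝ) ≤ ((m + 1 : ℕ) : ℝ) := by nlinarith
    exact_mod_cast this
  rw [Nat.cast_sub hkm] at hsum'
  constructor
  · rw [le_div_iff₀ hpos]
    exact (mul_le_mul_of_nonneg_right (hcpos s) hpos.le).trans hle'
  · rw [div_le_iff₀ hpos]
    have hc1 : (1 - π0 * π s) * P ≤ P := by
      have := mul_nonneg h0.le (hπ01 s).1
      nlinarith
    have h4 : ((m + 1 : ℕ) : ℝ) * Real.exp (-ε) * Q ≤ ((m + 1 : ℕ) : ℝ) * P := by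
      refine le_trans (mul_le_mul_of_nonneg_right ?_ hQ)
        (hsum'.trans (mul_le_mul_of_nonneg_left hc1 hmpos.le))
      have : Real.exp (-ε) = 1 - π0 := by rw [hπ0]; ring
      rw [this]; nlinarith
    rw [mul_assoc] at h4
    have h5 := le_of_mul_le_mul_left h4 hmpos
    have h6 := mul_le_mul_of_nonneg_left h5 (Real.exp_pos ε).le
    rwa [← mul_assoc, ← Real.exp_add, add_neg_cancel, Real.exp_zero, one_mul] at h6
end

section
/- Fix ε > 0, π0 := 1 − e^{−ε}, and n0 := ⌈k_max/(1 − e^{−ε})⌉. Suppose the downsampled sketch f' (each item retained iff an independent uniform hash lies below π0, retained items fed to the base sketch f) is initialized by inserting n0 distinct phantom items drawn from a universe disjoint from the real stream items. Then for every real-stream cardinality n ≥ 1, the resulting sketch of the n + n0 distinct items satisfies e^{−ε} ≤ Pr(S'_{n+n0} = s)/Pr(S'_{n−1+n0} = s) ≤ e^{ε} for every state s with positive denominator; that is, the procedure DPSketchAnySet is ε-differentially private with respect to the presence or absence of a single real stream item, for streams of any cardinality n ≥ 1. -/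
open MeasureTheory

attribute [local instance] Classical.propDecidable

lemma aux_Aerase {X : Type*} {n : ℕ} (i : Fin (n+1)) (ω : Fin (n+1) → X) :
    Aerase i ω = Afull (i.removeNth ω) := by
  ext x
  simp only [Aerase, Afull, Finset.mem_image, Finset.mem_erase, Finset.mem_univ, and_true,
    true_and, Fin.removeNth]
  constructor
  · rintro ⟨j, hj, rfl⟩
    obtain ⟨k, rfl⟩ := Fin.exists_succAbove_eq hj
    exact ⟨k, rfl⟩
  · rintro ⟨k, rfl⟩
    exact ⟨_, Fin.succAbove_ne i k, rfl⟩

lemma aux_prod {X : Type*} [MeasurableSpace X] (ν : Measure X) [IsProbabilityMeasure ν]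
    {n : ℕ} (i : Fin (n+1)) (B : Set X) (hB : MeasurableSet B) (E : Set (Fin n → X))
    (hE : MeasurableSet E) :
    streamP ν (n+1) {ω | ω i ∈ B ∧ i.removeNth ω ∈ E} = ν B * streamP ν n E := by
  have h := (measurePreserving_piFinSuccAbove (fun _ : Fin (n+1) => ν) i)
  have h2 := h.measure_preimage (hB.prod hE).nullMeasurableSet
  rw [Measure.prod_prod] at h2
  exact h2

lemma aux_upper {X Ω : Type*} [MeasurableSpace X] (ν : Measure X) [IsProbabilityMeasure ν]
    (F : Finset X → Ω) (kmax : ℕ) (M : ℕ) (s : Ω)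
    (hm : ∀ n, MeasurableSet {ω : Fin n → X | F (Afull ω) = s})
    (hK : ∀ ω : Fin (M+1) → X, (Kset F ω).card ≤ kmax) :
    ((M+1 : ℕ) : ENNReal) * streamP ν (M+1) {ω | F (Afull ω) = s} ≤
      ((M+1 : ℕ) : ENNReal) * streamP ν M {ω | F (Afull ω) = s}
        + kmax * streamP ν (M+1) {ω | F (Afull ω) = s} := by
  have hA : ∀ i : Fin (M+1), streamP ν (M+1) {ω | F (Aerase i ω) = s}
      = streamP ν M {ω | F (Afull ω) = s} := by
    intro i
    have := aux_prod ν i Set.univ MeasurableSet.univ _ (hm M)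
    simpa [aux_Aerase] using this
  have hmA : ∀ i : Fin (M+1), MeasurableSet {ω : Fin (M+1) → X | F (Aerase i ω) = s} := by
    intro i
    have h := (measurePreserving_piFinSuccAbove (fun _ : Fin (M+1) => ν) i).measurable
    have := (measurable_snd.comp h) (hm M)
    simp only [aux_Aerase]
    exact this
  have key : ∫⁻ ω, ((M+1 : ℕ) : ENNReal) *
        Set.indicator {ω : Fin (M+1) → X | F (Afull ω) = s} 1 ω ∂(streamP ν (M+1)) ≤
      ∫⁻ ω, ((∑ i : Fin (M+1), Set.indicator {ω : Fin (M+1) → X | F (Aerase i ω) = s} 1 ω)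
        + kmax * Set.indicator {ω : Fin (M+1) → X | F (Afull ω) = s} 1 ω) ∂(streamP ν (M+1)) := by
    apply lintegral_mono
    intro ω
    beta_reduce
    by_cases hs : F (Afull ω) = s
    · have h1 : (∑ i : Fin (M+1),
          Set.indicator {ω : Fin (M+1) → X | F (Aerase i ω) = s} (1 : (Fin (M+1) → X) → ENNReal) ω)
          = ((Finset.univ.filter fun i : Fin (M+1) => F (Aerase i ω) = s).card : ENNReal) := by
        simp [Set.indicator_apply, Finset.sum_ite]
      have h2 := hK ω
      have h3 := Finset.card_filter_add_card_filter_not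
        (s := (Finset.univ : Finset (Fin (M+1)))) (fun i => F (Aerase i ω) = s)
      simp only [Kset, hs, ne_eq] at h2
      simp only [Finset.card_univ, Fintype.card_fin] at h3
      rw [h1]
      simp only [Set.indicator_apply, Set.mem_ofPred_eq, hs, if_true, Pi.one_apply, mul_one]
      norm_cast
      omega
    · simp [Set.indicator_apply, hs]
  rw [lintegral_const_mul _ (measurable_one.indicator (hm _)),
    lintegral_add_right _ ((measurable_one.indicator (hm _)).const_mul _),
    lintegral_finsetSum _ (fun i _ => measurable_one.indicator (hmA i)),
    lintegral_const_mul _ (measurable_one.indicator (hm _)),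
    lintegral_indicator_one (hm _)] at key
  simp only [lintegral_indicator_one (hmA _), hA] at key
  simpa using key

lemma aux_down {H Ω : Type*} (f : Finset H → Ω) (c : ℝ) {n : ℕ} (ω : Fin n → ℝ × H)
    (S : Finset (Fin n)) {_ : DecidableEq (ℝ × H)} :
    downsample f c (S.image ω) = f ((S.filter fun j => (ω j).1 < c).image fun j => (ω j).2) := by
  unfold downsample
  congr 1
  ext x
  simp only [Finset.mem_image, Finset.mem_filter]
  constructor
  · rintro ⟨p, ⟨⟨j, hj, rfl⟩, hp⟩, rfl⟩
    exact ⟨j, ⟨hj, hp⟩, rfl⟩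
  · rintro ⟨j, ⟨hj, hp⟩, rfl⟩
    exact ⟨_, ⟨⟨j, hj, rfl⟩, hp⟩, rfl⟩

lemma aux_meas_s9 {H Ω : Type*} [MeasurableSpace H] [MeasurableSingletonClass H] [Countable H]
    (f : Finset H → Ω) (c : ℝ) (n : ℕ) (s : Ω) :
    MeasurableSet {ω : Fin n → ℝ × H | downsample f c (Afull ω) = s} := by
  have hg : Measurable (fun (ω : Fin n → ℝ × H) (j : Fin n) => (decide ((ω j).1 < c), (ω j).2)) := by
    refine measurable_pi_lambda _ fun j => Measurable.prodMk ?_ ?_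
    · refine measurable_to_bool ?_
      have : MeasurableSet {ω : Fin n → ℝ × H | (ω j).1 < c} :=
        measurableSet_lt (measurable_fst.comp (measurable_pi_apply j)) measurable_const
      convert this using 1
      ext ω
      simp
    · exact measurable_snd.comp (measurable_pi_apply j)
  have := hg (MeasurableSet.of_discrete (s := {τ : Fin n → Bool × H |
    f ((Finset.univ.filter fun j => (τ j).1 = true).image fun j => (τ j).2) = s}))
  convert this using 1
  ext ω
  simp only [Afull, aux_down, Set.mem_ofPred_eq, Set.mem_preimage, decide_eq_true_eq]

lemma aux_K {H Ω : Type*} (f : Finset H → Ω) (c : ℝ) (kmax : ℕ)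
    (hK : ∀ (m : ℕ) (ω : Fin m → H), (Kset f ω).card ≤ kmax)
    (n : ℕ) (ω : Fin n → ℝ × H) : (Kset (downsample f c) ω).card ≤ kmax := by
  set R := Finset.univ.filter fun j => (ω j).1 < c with hR
  let e := R.orderEmbOfFin rfl
  have he : ∀ j, j ∈ R ↔ ∃ k, e k = j := by
    intro j
    have := Finset.range_orderEmbOfFin R rfl
    rw [← Finset.mem_coe, ← this]
    rfl
  refine le_trans ?_ (hK R.card (fun k => (ω (e k)).2))
  rw [← Finset.card_map e.toEmbedding]
  apply Finset.card_le_card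
  intro i hi
  have hfull : f (Afull fun k => (ω (e k)).2) = downsample f c (Afull ω) := by
    rw [Afull, Afull, aux_down, ← hR]
    congr 1
    ext x
    simp [he]
  simp only [Kset, Finset.mem_filter, Finset.mem_univ, true_and] at hi
  by_cases hiR : i ∈ R
  · obtain ⟨k, rfl⟩ := (he i).1 hiR
    refine Finset.mem_map.2 ⟨k, ?_, rfl⟩
    simp only [Kset, Finset.mem_filter, Finset.mem_univ, true_and]
    rw [hfull]
    convert hi using 1
    rw [Aerase, Aerase, aux_down, Finset.filter_erase, ← hR]
    congr 1
    ext x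
    simp only [Finset.mem_image, Finset.mem_erase, Finset.mem_univ, and_true]
    constructor
    · rintro ⟨l, hl, rfl⟩
      exact ⟨e l, ⟨fun h => hl (e.injective h), (he _).2 ⟨l, rfl⟩⟩, rfl⟩
    · rintro ⟨j, ⟨hj, hjR⟩, rfl⟩
      obtain ⟨l, rfl⟩ := (he j).1 hjR
      exact ⟨l, fun h => hj (by rw [h]), rfl⟩
  · exfalso
    apply hi
    rw [Aerase, Afull, aux_down, aux_down, Finset.filter_erase, ← hR, Finset.erase_eq_of_notMem hiR]

lemma aux_lower {H Ω : Type*} [MeasurableSpace H] [MeasurableSingletonClass H] [Countable H]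
    (μ : Measure H) [IsProbabilityMeasure μ] [IsProbabilityMeasure (augLaw μ)]
    (f : Finset H → Ω) (c : ℝ) (hc0 : 0 ≤ c) (M : ℕ) (s : Ω) :
    ENNReal.ofReal (1 - c) * streamP (augLaw μ) M {ω | downsample f c (Afull ω) = s} ≤
      streamP (augLaw μ) (M+1) {ω | downsample f c (Afull ω) = s} := by
  have hB : augLaw μ (Set.Ici c ×ˢ Set.univ) = ENNReal.ofReal (1 - c) := by
    rw [augLaw, Measure.prod_prod, Measure.restrict_apply measurableSet_Ici, measure_univ, mul_one]
    have : Set.Ici c ∩ Set.Icc (0:ℝ) 1 = Set.Icc c 1 := by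
      ext x
      simp only [Set.mem_inter_iff, Set.mem_Ici, Set.mem_Icc]
      constructor
      · rintro ⟨h1, h2, h3⟩
        exact ⟨h1, h3⟩
      · rintro ⟨h1, h2⟩
        exact ⟨h1, hc0.trans h1, h2⟩
    rw [this, Real.volume_Icc]
  rw [← hB, ← aux_prod (augLaw μ) 0 _ (measurableSet_Ici.prod MeasurableSet.univ) _
    (aux_meas_s9 f c M s)]
  apply measure_mono
  rintro ω ⟨h1, h2⟩
  simp only [Set.mem_ofPred_eq] at h2 ⊢
  rw [← h2, ← aux_Aerase, Aerase, Afull, aux_down, aux_down, Finset.filter_erase,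
    Finset.erase_eq_of_notMem]
  have : c ≤ (ω 0).1 := h1.1
  simpa using this

/-!
STATEMENT 9: With `π0 := 1 - e^{-ε}` and `n0 := ⌈k_max/(1 - e^{-ε})⌉`, the
downsampled sketch initialized with `n0` distinct phantom items (i.e. run on
`n + n0` distinct items) satisfies, for every real-stream cardinality `n ≥ 1`,
`e^{-ε} ≤ Pr(S'_{n+n0} = s)/Pr(S'_{n-1+n0} = s) ≤ e^ε` for every state `s`
with positive denominator: DPSketchAnySet is ε-differentially private with
respect to the presence or absence of a single real stream item.
-/

theorem downsampled_phantom_sketch_eps_dp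
    {H : Type*} [MeasurableSpace H] [MeasurableSingletonClass H] [Countable H]
    {Ω : Type*} [Fintype Ω]
    (μ : Measure H) [IsProbabilityMeasure μ]
    (f : Finset H → Ω) (π : Ω → ℝ)
    (hπ01 : ∀ t : Ω, π t ∈ Set.Icc (0 : ℝ) 1)
    (hπ : ∀ A : Finset H, (μ {y | f (insert y A) ≠ f A}).toReal = π (f A))
    (ε : ℝ) (hε : 0 < ε) (kmax : ℕ)
    (hK : ∀ (m : ℕ) (ω : Fin m → H), (Kset f ω).card ≤ kmax)
    (n0 : ℕ) (hn0 : n0 = ⌈(kmax : ℝ) / (1 - Real.exp (-ε))⌉₊) :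
    ∀ n : ℕ, 1 ≤ n →
      ∀ s : Ω,
        0 < ((streamP (augLaw μ) (n - 1 + n0))
            {ω | downsample f (1 - Real.exp (-ε)) (Afull ω) = s}).toReal →
        Real.exp (-ε) ≤
            ((streamP (augLaw μ) (n + n0))
                {ω | downsample f (1 - Real.exp (-ε)) (Afull ω) = s}).toReal /
              ((streamP (augLaw μ) (n - 1 + n0))
                {ω | downsample f (1 - Real.exp (-ε)) (Afull ω) = s}).toReal ∧
          ((streamP (augLaw μ) (n + n0))
                {ω | downsample f (1 - Real.exp (-ε)) (Afull ω) = s}).toReal /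
              ((streamP (augLaw μ) (n - 1 + n0))
                {ω | downsample f (1 - Real.exp (-ε)) (Afull ω) = s}).toReal ≤
            Real.exp ε := by
  intro n hn s hpos
  obtain ⟨m, rfl⟩ : ∃ m, n = m + 1 := ⟨n - 1, by omega⟩
  have e1 : m + 1 - 1 + n0 = m + n0 := by omega
  have e2 : m + 1 + n0 = (m + n0) + 1 := by omega
  rw [e1] at hpos ⊢
  rw [e2]
  set c := 1 - Real.exp (-ε) with hc
  have hexp : Real.exp (-ε) < 1 := by
    rw [Real.exp_lt_one_iff]
    linarith
  have hc0 : 0 < c := by rw [hc]; linarith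
  haveI : IsProbabilityMeasure (volume.restrict (Set.Icc (0 : ℝ) 1)) := ⟨by simp⟩
  haveI : IsProbabilityMeasure (augLaw μ) := by
    unfold augLaw
    infer_instance
  haveI : ∀ k, IsProbabilityMeasure (streamP (augLaw μ) k) := by
    intro k
    unfold streamP
    infer_instance
  have hl := aux_lower μ f c hc0.le (m + n0) s
  have hu := aux_upper (augLaw μ) (downsample f c) kmax (m + n0) s
    (fun n => aux_meas_s9 f c n s) (fun ω => aux_K f c kmax hK _ ω)
  have hl' := ENNReal.toReal_mono (measure_ne_top _ _) hl
  have hu' := ENNReal.toReal_mono (by finiteness) hu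
  rw [ENNReal.toReal_mul, ENNReal.toReal_ofReal (by rw [hc]; linarith [Real.exp_pos (-ε)])] at hl'
  rw [ENNReal.toReal_add (by finiteness) (by finiteness), ENNReal.toReal_mul,
    ENNReal.toReal_mul, ENNReal.toReal_mul, ENNReal.toReal_natCast, ENNReal.toReal_natCast] at hu'
  set P := ((streamP (augLaw μ) (m + n0)) {ω | downsample f c (Afull ω) = s}).toReal
  set Q := ((streamP (augLaw μ) (m + n0 + 1)) {ω | downsample f c (Afull ω) = s}).toReal
  have hQ : 0 ≤ Q := ENNReal.toReal_nonneg
  have hk : (kmax : ℝ) ≤ c * ((m + n0 + 1 : ℕ) : ℝ) := by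
    have h1 : (kmax : ℝ) / c ≤ n0 := by rw [hn0]; exact Nat.le_ceil _
    rw [div_le_iff₀ hc0] at h1
    push_cast
    nlinarith [mul_nonneg hc0.le (Nat.cast_nonneg (α := ℝ) m)]
  have hN : (0 : ℝ) < ((m + n0 + 1 : ℕ) : ℝ) := by positivity
  have h1c : 1 - c = Real.exp (-ε) := by rw [hc]; ring
  rw [h1c] at hl'
  constructor
  · rw [le_div_iff₀ hpos]
    exact hl'
  · rw [div_le_iff₀ hpos]
    have h3 : Real.exp (-ε) * Q ≤ P := by
      rw [← h1c]
      refine le_of_mul_le_mul_left ?_ hN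
      nlinarith [mul_le_mul_of_nonneg_right hk hQ]
    calc Q = Real.exp ε * (Real.exp (-ε) * Q) := by
          rw [← mul_assoc, ← Real.exp_add]; simp
      _ ≤ Real.exp ε * P := by gcongr
end

section
/- Assume the sketch admits a merge operation: a function m : Ω × Ω → Ω such that f(A ∪ B) = m(f(A), f(B)) for all finite sets A, B ⊆ H. Then for all finite A, B ⊆ H and y ∈ H, if f(B ∪ {y}) = f(B) then f(A ∪ B ∪ {y}) = f(A ∪ B); consequently the state-dependent sampling probability satisfies π(f(A ∪ B)) ≤ min( π(f(A)), π(f(B)) ). -/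
open MeasureTheory

attribute [local instance] Classical.propDecidable

/-!
STATEMENT 10: If the sketch admits a merge operation `m` with
`f(A ∪ B) = m(f(A), f(B))`, then an item that does not change the sketch of
`B` does not change the sketch of `A ∪ B`; consequently
`π(f(A ∪ B)) ≤ min(π(f(A)), π(f(B)))`.
-/

theorem merge_sketch_sampling_prob_le
    {H : Type*} [MeasurableSpace H] {Ω : Type*}
    (μ : Measure H) [IsProbabilityMeasure μ]
    (f : Finset H → Ω) (π : Ω → ℝ)
    (hπ : ∀ A : Finset H, (μ {y | f (insert y A) ≠ f A}).toReal = π (f A))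
    (m : Ω → Ω → Ω)
    (hm : ∀ A B : Finset H, f (A ∪ B) = m (f A) (f B)) :
    (∀ (A B : Finset H) (y : H),
        f (B ∪ {y}) = f B → f (A ∪ B ∪ {y}) = f (A ∪ B)) ∧
      ∀ A B : Finset H, π (f (A ∪ B)) ≤ min (π (f A)) (π (f B)) := by
  have key : ∀ (A B : Finset H) (y : H),
      f (B ∪ {y}) = f B → f (A ∪ B ∪ {y}) = f (A ∪ B) := by
    intro A B y h
    rw [Finset.union_assoc, hm A (B ∪ {y}), h, ← hm]
  have right : ∀ A B : Finset H, π (f (A ∪ B)) ≤ π (f B) := by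
    intro A B
    rw [← hπ, ← hπ]
    refine ENNReal.toReal_mono (measure_ne_top μ _) (measure_mono ?_)
    intro y hy h
    apply hy
    have e : ∀ C : Finset H, insert y C = C ∪ {y} := fun C => by
      ext x
      simp [or_comm]
    rw [e] at h ⊢
    exact key A B y h
  refine ⟨key, fun A B => le_min ?_ (right A B)⟩
  rw [Finset.union_comm]
  exact right B A
end

section
/- Let p ∈ (0,1], n a natural number, V an integrable nonnegative-integer-valued random variable, Z a random variable whose conditional distribution given V = v is Binomial(n + v, p), and N̂_base an integrable real random variable with E[N̂_base | V, Z] = Z almost surely. Then E[ N̂_base/p − V ] = n. -/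
open MeasureTheory

/-!
STATEMENT 11: Let `p ∈ (0,1]`, `V` an integrable ℕ-valued random variable,
`Z` conditionally `Binomial(n + v, p)` given `V = v`, and `N̂_base` integrable
with `E[N̂_base | V, Z] = Z` a.s. Then `E[N̂_base/p − V] = n`.
(The conditional hypotheses are expressed via the discrete conditioning
events `{V = v, Z = z}`.)
-/

lemma binom_mean_aux (m : ℕ) (p : ℝ) :
    ∑ z ∈ Finset.range (m + 1), (z : ℝ) * ((m.choose z : ℝ) * p ^ z * (1 - p) ^ (m - z))
      = m * p := by
  have h := congrArg (Polynomial.eval p) (bernsteinPolynomial.sum_smul ℝ m)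
  simpa [Polynomial.eval_finsetSum, bernsteinPolynomial] using h

lemma hasSum_fiber_aux {α : Type*} [MeasurableSpace α] (P : Measure α)
    (V : α → ℕ) (hV : Measurable V) (f : α → ℝ) (hf : Integrable f P) :
    HasSum (fun v : ℕ => ∫ ω in {ω | V ω = v}, f ω ∂P) (∫ ω, f ω ∂P) := by
  have h := hasSum_integral_iUnion (μ := P) (f := f) (s := fun v : ℕ => {ω | V ω = v})
    (fun v => hV (measurableSet_singleton v))
    (fun i j hij => Set.disjoint_left.mpr fun ω hi hj => hij (hi.symm.trans hj))
    hf.integrableOn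
  have hu : (⋃ v : ℕ, {ω | V ω = v}) = Set.univ := by
    ext ω; simp
  rwa [hu, setIntegral_univ] at h

theorem private_estimator_unbiased
    {α : Type*} [MeasurableSpace α]
    (P : Measure α) [IsProbabilityMeasure P]
    (p : ℝ) (hp : 0 < p) (hp1 : p ≤ 1) (n : ℕ)
    (V Z : α → ℕ) (hV : Measurable V) (hZ : Measurable Z)
    (hVint : Integrable (fun ω => (V ω : ℝ)) P)
    (Nb : α → ℝ) (hNint : Integrable Nb P)
    (hbin : ∀ v z : ℕ,
      (P {ω | V ω = v ∧ Z ω = z}).toReal =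
        ((n + v).choose z : ℝ) * p ^ z * (1 - p) ^ (n + v - z) *
          (P {ω | V ω = v}).toReal)
    (hunb : ∀ v z : ℕ,
      ∫ ω in {ω | V ω = v ∧ Z ω = z}, Nb ω ∂P =
        (z : ℝ) * (P {ω | V ω = v ∧ Z ω = z}).toReal) :
    ∫ ω, (Nb ω / p - (V ω : ℝ)) ∂P = (n : ℝ) := by
  have hfib : ∀ v : ℕ, ∫ ω in {ω | V ω = v}, Nb ω ∂P
      = ∫ ω in {ω | V ω = v}, p * ((n : ℝ) + V ω) ∂P := by
    intro v
    have hmv : MeasurableSet {ω | V ω = v} := hV (measurableSet_singleton v)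
    have h1 := hasSum_fiber_aux (P.restrict {ω | V ω = v}) Z hZ Nb hNint.integrableOn
    have h2 : ∀ z : ℕ, ∫ ω in {ω | Z ω = z}, Nb ω ∂(P.restrict {ω | V ω = v})
        = (z : ℝ) * (((n + v).choose z : ℝ) * p ^ z * (1 - p) ^ (n + v - z)) *
          (P {ω | V ω = v}).toReal := by
      intro z
      have hmz : MeasurableSet {ω | Z ω = z} := hZ (measurableSet_singleton z)
      have hs : {ω | Z ω = z} ∩ {ω | V ω = v} = {ω | V ω = v ∧ Z ω = z} := by
        ext ω; simp [and_comm]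
      rw [Measure.restrict_restrict hmz, hs, hunb, hbin]
      ring
    simp only [h2] at h1
    have h3 := hasSum_sum_of_ne_finset_zero (L := SummationFilter.unconditional ℕ) (s := Finset.range (n + v + 1))
      (f := fun z : ℕ => (z : ℝ) * (((n + v).choose z : ℝ) * p ^ z * (1 - p) ^ (n + v - z)) *
          (P {ω | V ω = v}).toReal) (by
        intro z hz
        have : n + v < z := by simpa [Nat.lt_succ_iff] using hz
        simp [Nat.choose_eq_zero_of_lt this])
    rw [h1.unique h3, ← Finset.sum_mul, binom_mean_aux]
    have h4 : ∫ ω in {ω | V ω = v}, p * ((n : ℝ) + V ω) ∂P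
        = ∫ ω in {ω | V ω = v}, p * ((n : ℝ) + v) ∂P := by
      apply setIntegral_congr_fun hmv
      intro ω hω
      have : V ω = v := hω
      simp [this]
    rw [h4, setIntegral_const, smul_eq_mul, Measure.real]
    push_cast
    ring
  have hnV : Integrable (fun ω => (n : ℝ) + V ω) P := (integrable_const _).add hVint
  have hA := hasSum_fiber_aux P V hV Nb hNint
  have hB := hasSum_fiber_aux P V hV _ (hnV.const_mul p)
  simp only [hfib] at hA
  have hE := hA.unique hB
  rw [integral_sub (hNint.div_const p) hVint, integral_div, hE, integral_const_mul,
    integral_add (integrable_const _) hVint]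
  simp [hp.ne']
end

section
/- Model the LPCA sketch with downsampling probability p ∈ (0,1] and k bits as a hash-based order-invariant sketch: the hash space is H = {⊥} ∪ {1, …, k} with μ(⊥) = 1 − p and μ(i) = p/k for each i ∈ {1, …, k}, and the sketch map is f(A) := A ∩ {1, …, k} (the set of filled bits). Then the state-dependent sampling probability is π(f(A)) = p · (1 − |A ∩ {1,…,k}|/k) ≤ p, at most k items can change the sketch by removal (k_max ≤ k), and consequently, for ε > 0, if p < 1 − e^{−ε} and the stream contains n > k/(1 − e^{−ε}) distinct items, then LPCA is ε-differentially private: e^{−ε} < Pr(S_n = s)/Pr(S_{n−1} = s) < e^{ε} for every state s with positive denominator. -/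
open MeasureTheory

attribute [local instance] Classical.propDecidable

/-- The LPCA sketch map: a hash value `0 : Fin (k+1)` is the "discarded"
symbol `⊥`, and the hash value `i.succ` sets bit `i`; the sketch state is the
set of filled bits. -/
noncomputable def lpca (k : ℕ) : Finset (Fin (k + 1)) → Finset (Fin k) :=
  fun A => Finset.univ.filter fun i : Fin k => i.succ ∈ A

/-!
STATEMENT 17: Model LPCA with downsampling probability `p` and `k` bits as a
hash-based order-invariant sketch on `H = {⊥} ∪ {1,…,k}` with
`μ(⊥) = 1 − p`, `μ(i) = p/k`, and sketch map the set of filled bits. Then the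
state-dependent sampling probability is `p·(1 − |s|/k) ≤ p`, at most `k`
items can change the sketch by removal, and if `p < 1 − e^{−ε}` and
`n > k/(1 − e^{−ε})` then LPCA is ε-differentially private.
-/

theorem afull_eq_insert {H : Type*} [DecidableEq H] {m : ℕ} (i : Fin (m + 1)) (ω : Fin (m + 1) → H) :
    Afull ω = insert (ω i) (Aerase i ω) := by
  ext x
  simp only [Afull, Aerase, Finset.mem_image, Finset.mem_insert, Finset.mem_erase,
    Finset.mem_univ, and_true, true_and]
  constructor
  · rintro ⟨j, rfl⟩
    by_cases h : j = i
    · left; rw [h]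
    · right; exact ⟨j, h, rfl⟩
  · rintro (rfl | ⟨j, _, rfl⟩)
    · exact ⟨i, rfl⟩
    · exact ⟨j, rfl⟩

theorem aerase_eq_afull {H : Type*} {m : ℕ} (i : Fin (m + 1)) (ω : Fin (m + 1) → H) :
    Aerase i ω = Afull (i.removeNth ω) := by
  ext x
  simp only [Afull, Aerase, Finset.mem_image, Finset.mem_erase,
    Finset.mem_univ, and_true, true_and, Fin.removeNth]
  constructor
  · rintro ⟨j, hj, rfl⟩
    obtain ⟨l, rfl⟩ := Fin.exists_succAbove_eq hj
    exact ⟨l, rfl⟩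
  · rintro ⟨l, rfl⟩
    exact ⟨_, Fin.succAbove_ne i l, rfl⟩

theorem lpca_insert_zero (k : ℕ) (A : Finset (Fin (k + 1))) :
    lpca k (insert 0 A) = lpca k A := by
  ext i
  simp [lpca, Fin.succ_ne_zero]

theorem kset_card_le (k m : ℕ) (ω : Fin m → Fin (k + 1)) : (Kset (lpca k) ω).card ≤ k := by
  cases m with
  | zero =>
    have := Finset.card_le_univ (Kset (lpca k) ω)
    simp at this
    simp [this]
  | succ m =>
    have hc : ((Finset.univ : Finset (Fin (k + 1))).erase 0).card = k := by simp
    refine le_trans ?_ hc.le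
    apply Finset.card_le_card_of_injOn ω
    · intro i hi
      simp only [Kset, Finset.coe_filter, Finset.mem_univ, true_and, Set.mem_ofPred_eq] at hi
      simp only [Finset.coe_erase, Finset.coe_univ, Set.mem_sdiff, Set.mem_univ, true_and,
        Set.mem_singleton_iff]
      intro h0
      apply hi
      rw [afull_eq_insert i, h0, lpca_insert_zero]
    · intro i hi j hj hij
      simp only [Kset, Finset.coe_filter, Finset.mem_univ, true_and, Set.mem_ofPred_eq] at hi
      by_contra hne
      apply hi
      rw [afull_eq_insert i, Finset.insert_eq_of_mem]
      rw [hij]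
      simp only [Aerase, Finset.mem_image, Finset.mem_erase, Finset.mem_univ, and_true]
      exact ⟨j, Ne.symm hne, rfl⟩

theorem stream_erase (k m : ℕ) (μ : Measure (Fin (k + 1))) [IsProbabilityMeasure μ]
    (i : Fin (m + 1)) (T : Set (Fin (k + 1))) (B : Set (Fin m → Fin (k + 1))) :
    streamP μ (m + 1) {ω | ω i ∈ T ∧ i.removeNth ω ∈ B} = μ T * streamP μ m B := by
  have h := (measurePreserving_piFinSuccAbove (fun _ : Fin (m + 1) => μ) i).measure_preimage
    (s := T ×ˢ B) (MeasurableSet.of_discrete.nullMeasurableSet)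
  rw [Measure.prod_prod] at h
  exact h

theorem lpca_sampling (k : ℕ) (hk : 1 ≤ k) (p : ℝ) (hp : 0 < p)
    (μ : Measure (Fin (k + 1))) 
    (hbit : ∀ i : Fin k, μ {i.succ} = ENNReal.ofReal (p / (k : ℝ)))
    (A : Finset (Fin (k + 1))) :
    (μ {y | lpca k (insert y A) ≠ lpca k A}).toReal =
            p * (1 - ((lpca k A).card : ℝ) / (k : ℝ)) := by
  have hset : {y | lpca k (insert y A) ≠ lpca k A} =
      (((lpca k A)ᶜ.map (Fin.succEmb k) : Finset (Fin (k + 1))) : Set (Fin (k + 1))) := by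
    ext y
    simp only [Set.mem_ofPred_eq, Finset.coe_map, Set.mem_image, Finset.mem_coe,
      Finset.mem_compl]
    refine Fin.cases ?_ (fun j => ?_) y
    · simp [lpca_insert_zero, Fin.succ_ne_zero]
    · constructor
      · intro h
        refine ⟨j, fun hj => h ?_, rfl⟩
        rw [Finset.insert_eq_of_mem]
        simpa [lpca] using hj
      · rintro ⟨l, hl, hlj⟩ h
        have : l = j := Fin.succ_injective _ hlj
        subst this
        apply hl
        rw [← h]
        simp [lpca]
  rw [hset, ← sum_measure_singleton, Finset.sum_map]
  have hk0 : (0 : ℝ) < k := by exact_mod_cast hk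
  have hcard : (lpca k A).card ≤ k := by simpa using Finset.card_le_univ (lpca k A)
  simp only [Fin.coe_succEmb, hbit, Finset.sum_const, Finset.card_compl, Fintype.card_fin,
    nsmul_eq_mul, ENNReal.toReal_mul, ENNReal.toReal_natCast]
  rw [ENNReal.toReal_ofReal (by positivity), Nat.cast_sub hcard]
  field_simp

theorem stream_upper (k m : ℕ) (μ : Measure (Fin (k + 1))) [IsProbabilityMeasure μ]
    (s : Finset (Fin k)) :
    ((m + 1 - k : ℕ) : ENNReal) * streamP μ (m + 1) {ω | lpca k (Afull ω) = s} ≤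
      ((m + 1 : ℕ) : ENNReal) * streamP μ m {ω | lpca k (Afull ω) = s} := by
  have hE : ∀ i : Fin (m + 1), streamP μ (m + 1) {ω | lpca k (Aerase i ω) = s} =
      streamP μ m {ω | lpca k (Afull ω) = s} := by
    intro i
    have := stream_erase k m μ i Set.univ {ω | lpca k (Afull ω) = s}
    simpa [aerase_eq_afull] using this
  have h1 : ∑ i : Fin (m + 1), streamP μ (m + 1) {ω | lpca k (Aerase i ω) = s} =
      ((m + 1 : ℕ) : ENNReal) * streamP μ m {ω | lpca k (Afull ω) = s} := by
    simp [hE]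
  rw [← h1, ← lintegral_indicator_const MeasurableSet.of_discrete]
  have h2 : ∀ i : Fin (m + 1), streamP μ (m + 1) {ω | lpca k (Aerase i ω) = s} =
      ∫⁻ ω, Set.indicator {ω | lpca k (Aerase i ω) = s} 1 ω ∂(streamP μ (m + 1)) := by
    intro i
    rw [lintegral_indicator_one MeasurableSet.of_discrete]
  simp only [h2]
  rw [← lintegral_finsetSum _ (fun i _ => measurable_of_finite _)]
  apply lintegral_mono
  intro ω
  by_cases hω : lpca k (Afull ω) = s
  · simp only [Set.indicator, Set.mem_ofPred_eq, hω, if_true, Pi.one_apply]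
    rw [Finset.sum_boole]
    norm_cast
    have hK := kset_card_le k (m + 1) ω
    have := Finset.card_filter_add_card_filter_not (s := (Finset.univ : Finset (Fin (m + 1))))
      (fun i => lpca k (Aerase i ω) = s)
    simp only [Kset, hω, ne_eq] at hK
    simp only [Finset.card_univ, Fintype.card_fin] at this
    omega
  · simp [Set.indicator, hω]

theorem lpca_eps_dp
    (k : ℕ) (hk : 1 ≤ k) (p : ℝ) (hp : 0 < p) (hp1 : p ≤ 1)
    (μ : Measure (Fin (k + 1))) [IsProbabilityMeasure μ]
    (hbot : μ {0} = ENNReal.ofReal (1 - p))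
    (hbit : ∀ i : Fin k, μ {i.succ} = ENNReal.ofReal (p / (k : ℝ)))
    (ε : ℝ) (hε : 0 < ε) :
    (∀ A : Finset (Fin (k + 1)),
        (μ {y | lpca k (insert y A) ≠ lpca k A}).toReal =
            p * (1 - ((lpca k A).card : ℝ) / (k : ℝ)) ∧
          p * (1 - ((lpca k A).card : ℝ) / (k : ℝ)) ≤ p) ∧
      (∀ (m : ℕ) (ω : Fin m → Fin (k + 1)), (Kset (lpca k) ω).card ≤ k) ∧
      (p < 1 - Real.exp (-ε) →
        ∀ n : ℕ, (k : ℝ) / (1 - Real.exp (-ε)) < (n : ℝ) →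
          ∀ s : Finset (Fin k),
            0 < ((streamP μ (n - 1)) {ω | lpca k (Afull ω) = s}).toReal →
            Real.exp (-ε) <
                ((streamP μ n) {ω | lpca k (Afull ω) = s}).toReal /
                  ((streamP μ (n - 1)) {ω | lpca k (Afull ω) = s}).toReal ∧
              ((streamP μ n) {ω | lpca k (Afull ω) = s}).toReal /
                  ((streamP μ (n - 1)) {ω | lpca k (Afull ω) = s}).toReal <
                Real.exp ε) := by
  have hk0 : (0 : ℝ) < k := by exact_mod_cast hk
  refine ⟨fun A => ⟨lpca_sampling k hk p hp μ hbit A, ?_⟩, kset_card_le k, ?_⟩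
  · have : 0 ≤ ((lpca k A).card : ℝ) / (k : ℝ) := by positivity
    nlinarith
  intro hpe n hn s hpos
  have hd : 0 < 1 - Real.exp (-ε) := hp.trans hpe
  rw [div_lt_iff₀ hd] at hn
  cases n with
  | zero => simp at hn; linarith
  | succ m =>
    change 0 < ((streamP μ m) {ω | lpca k (Afull ω) = s}).toReal at hpos
    change Real.exp (-ε) < ((streamP μ (m + 1)) {ω | lpca k (Afull ω) = s}).toReal /
          ((streamP μ m) {ω | lpca k (Afull ω) = s}).toReal ∧
        ((streamP μ (m + 1)) {ω | lpca k (Afull ω) = s}).toReal /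
          ((streamP μ m) {ω | lpca k (Afull ω) = s}).toReal < Real.exp ε
    have hup := stream_upper k m μ s
    have hlow : μ {0} * streamP μ m {ω | lpca k (Afull ω) = s} ≤
        streamP μ (m + 1) {ω | lpca k (Afull ω) = s} := by
      rw [← stream_erase k m μ 0]
      apply measure_mono
      rintro ω ⟨h0, h1⟩
      simp only [Set.mem_singleton_iff, Set.mem_ofPred_eq] at h0 h1 ⊢
      rw [afull_eq_insert 0, h0, lpca_insert_zero, aerase_eq_afull, h1]
    have : ∀ l, IsProbabilityMeasure (streamP μ l) := fun l => by
      unfold streamP; infer_instance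
    have hkm : k ≤ m + 1 := by
      have : (k : ℝ) ≤ ((m + 1 : ℕ) : ℝ) := by
        have := Real.exp_pos (-ε)
        have : (0 : ℝ) ≤ ((m + 1 : ℕ) : ℝ) := by positivity
        nlinarith
      exact_mod_cast this
    have hup' := ENNReal.toReal_mono (ENNReal.mul_ne_top (ENNReal.natCast_ne_top _)
      (measure_ne_top _ _)) hup
    have hlow' := ENNReal.toReal_mono (measure_ne_top _ _) hlow
    rw [ENNReal.toReal_mul, ENNReal.toReal_mul, ENNReal.toReal_natCast, ENNReal.toReal_natCast,
      Nat.cast_sub hkm] at hup'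
    rw [ENNReal.toReal_mul, hbot, ENNReal.toReal_ofReal (by linarith)] at hlow'
    generalize ((streamP μ m) {ω | lpca k (Afull ω) = s}).toReal = a at *
    generalize ((streamP μ (m + 1)) {ω | lpca k (Afull ω) = s}).toReal = b at *
    generalize ((m + 1 : ℕ) : ℝ) = N at *
    constructor
    · rw [lt_div_iff₀ hpos]
      nlinarith
    · rw [div_lt_iff₀ hpos]
      have he : Real.exp ε * Real.exp (-ε) = 1 := by rw [← Real.exp_add]; simp
      have hepos := Real.exp_pos (-ε)
      have hepos' := Real.exp_pos ε
      have hN : 0 < N := by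
        by_contra hcon
        nlinarith
      have hb : 0 < b := by nlinarith
      have h3 : N * Real.exp (-ε) * b < N * a := by nlinarith
      have h4 : Real.exp (-ε) * b < a := by
        rw [mul_assoc] at h3
        exact lt_of_mul_lt_mul_left h3 hN.le
      calc b = Real.exp ε * (Real.exp (-ε) * b) := by rw [← mul_assoc, he, one_mul]
        _ < Real.exp ε * a := mul_lt_mul_of_pos_left h4 hepos'
end

section
/- Let X_1, …, X_n be i.i.d. Uniform[0,1] random variables, let k ≥ 1 be an integer and π0 ∈ (0,1) with k < n·π0, and let M_k denote the k-th smallest value among X_1, …, X_n. Then Pr(M_k > π0) = Pr(Y ≤ k − 1) ≤ Pr(Y ≤ k) ≤ exp(−n·α_n), where Y ∼ Binomial(n, π0) and α_n := (π0 − k/n)² / ( 2( π0(1 − π0) + (π0 − k/n)/3 ) ). -/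
open MeasureTheory

/-- The `k`-th smallest value among `ω 0, …, ω (n-1)` (1-indexed `k`). -/
noncomputable def kthSmallest (n k : ℕ) (ω : Fin n → ℝ) : ℝ :=
  ((Finset.univ.val.map ω).sort (· ≤ ·)).getD (k - 1) 0

theorem sorted_lt_getD_iff (a : ℝ) (l : List ℝ) (hl : l.Pairwise (· ≤ ·)) :
    ∀ i : ℕ, i < l.length → (a < l.getD i 0 ↔ l.countP (fun x => decide (x ≤ a)) ≤ i) := by
  induction l with
  | nil => intro i hi; simp at hi
  | cons b l ih =>
    intro i hi
    rw [List.pairwise_cons] at hl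
    by_cases hb : b ≤ a
    · rw [List.countP_cons_of_pos (by simpa using hb)]
      cases i with
      | zero => simp [hb]
      | succ i =>
        have := ih hl.2 i (by simpa using hi)
        simp only [List.getD_cons_succ, this]
        omega
    · have hz : (b :: l).countP (fun x => decide (x ≤ a)) = 0 := by
        rw [List.countP_eq_zero]
        intro x hx
        rcases List.mem_cons.1 hx with rfl | hx
        · simpa using hb
        · have := hl.1 x hx
          simp; linarith
      rw [hz]
      simp only [Nat.zero_le, iff_true]
      rw [List.getD_eq_getElem _ _ hi]
      have hx : (b :: l)[i] ∈ b :: l := List.getElem_mem hi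
      rcases List.mem_cons.1 hx with h | h
      · rw [h]; linarith
      · have := hl.1 _ h
        linarith

theorem lt_kthSmallest_iff (n k : ℕ) (hk : 1 ≤ k) (hkn : k ≤ n) (a : ℝ) (ω : Fin n → ℝ) :
    a < kthSmallest n k ω ↔ (Finset.univ.filter (fun i => ω i ≤ a)).card < k := by
  unfold kthSmallest
  rw [sorted_lt_getD_iff a _ (Multiset.pairwise_sort _ _) (k - 1) (by simp; omega)]
  rw [← Multiset.coe_countP (fun x => x ≤ a), Multiset.sort_eq, Multiset.countP_map]
  change (Finset.univ.filter (fun i => ω i ≤ a)).card ≤ k - 1 ↔ _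
  omega

theorem measure_part (n k : ℕ) (hk : 1 ≤ k) (hkn : k ≤ n) (p : ℝ) (h0 : 0 < p) (h1 : p < 1) :
    ((Measure.pi fun _ : Fin n => volume.restrict (Set.Icc (0 : ℝ) 1))
        {ω | p < kthSmallest n k ω}).toReal =
        ∑ j ∈ Finset.range k, (n.choose j : ℝ) * p ^ j * (1 - p) ^ (n - j) := by
  classical
  set B : Finset (Fin n) → Set (Fin n → ℝ) := fun S =>
    Set.univ.pi (fun i => if i ∈ S then Set.Iic p else Set.Ioi p) with hB
  have hmem : ∀ S ω, ω ∈ B S ↔ Finset.univ.filter (fun i => ω i ≤ p) = S := by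
    intro S ω
    simp only [hB, Set.mem_univ_pi, Finset.ext_iff, Finset.mem_filter, Finset.mem_univ, true_and]
    refine forall_congr' fun i => ?_
    by_cases hi : i ∈ S <;> simp [hi]
  have hset : {ω | p < kthSmallest n k ω} =
      ⋃ S ∈ Finset.univ.filter (fun S : Finset (Fin n) => S.card < k), B S := by
    ext ω
    simp only [Set.mem_ofPred_eq, lt_kthSmallest_iff n k hk hkn, Set.mem_iUnion, hmem]
    simp
  have hmeas : ∀ S, MeasurableSet (B S) := by
    intro S
    refine MeasurableSet.univ_pi fun i => ?_
    split_ifs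
    · exact measurableSet_Iic
    · exact measurableSet_Ioi
  have hI : (volume.restrict (Set.Icc (0 : ℝ) 1)) (Set.Iic p) = ENNReal.ofReal p := by
    rw [Measure.restrict_apply measurableSet_Iic]
    have : Set.Iic p ∩ Set.Icc (0 : ℝ) 1 = Set.Icc 0 p := by
      ext x; simp only [Set.mem_inter_iff, Set.mem_Iic, Set.mem_Icc]
      constructor
      · rintro ⟨a, b, c⟩; exact ⟨b, a⟩
      · rintro ⟨a, b⟩; exact ⟨b, a, by linarith⟩
    rw [this, Real.volume_Icc, sub_zero]
  have hO : (volume.restrict (Set.Icc (0 : ℝ) 1)) (Set.Ioi p) = ENNReal.ofReal (1 - p) := by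
    rw [Measure.restrict_apply measurableSet_Ioi]
    have : Set.Ioi p ∩ Set.Icc (0 : ℝ) 1 = Set.Ioc p 1 := by
      ext x; simp only [Set.mem_inter_iff, Set.mem_Ioi, Set.mem_Icc, Set.mem_Ioc]
      constructor
      · rintro ⟨a, b, c⟩; exact ⟨a, c⟩
      · rintro ⟨a, b⟩; exact ⟨a, by linarith, b⟩
    rw [this, Real.volume_Ioc]
  have hBm : ∀ S, (Measure.pi fun _ : Fin n => volume.restrict (Set.Icc (0 : ℝ) 1)) (B S) =
      ENNReal.ofReal (p ^ S.card * (1 - p) ^ (n - S.card)) := by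
    intro S
    rw [hB, Measure.pi_pi]
    have : ∀ i, (volume.restrict (Set.Icc (0 : ℝ) 1)) (if i ∈ S then Set.Iic p else Set.Ioi p)
        = if i ∈ S then ENNReal.ofReal p else ENNReal.ofReal (1 - p) := by
      intro i; split_ifs
      · exact hI
      · exact hO
    simp only [this]
    rw [Finset.prod_ite, Finset.prod_const, Finset.prod_const,
      ENNReal.ofReal_mul (by positivity), ENNReal.ofReal_pow h0.le,
      ENNReal.ofReal_pow (by linarith)]
    have e1 : Finset.univ.filter (fun i => i ∈ S) = S := by ext; simp
    have e2 : Finset.univ.filter (fun i => i ∉ S) = Sᶜ := by ext; simp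
    rw [e1, e2, Finset.card_compl, Fintype.card_fin]
  have hq : 0 < 1 - p := by linarith
  rw [hset, measure_biUnion_finset _ (fun S _ => hmeas S)]
  · simp only [hBm]
    rw [← ENNReal.ofReal_sum_of_nonneg (fun S _ => by positivity), ENNReal.toReal_ofReal
      (Finset.sum_nonneg fun S _ => by positivity), Finset.sum_filter]
    have := Finset.sum_powerset_apply_card (x := (Finset.univ : Finset (Fin n)))
      (fun m => if m < k then p ^ m * (1 - p) ^ (n - m) else 0)
    rw [Finset.powerset_univ] at this
    rw [this, Finset.card_univ, Fintype.card_fin]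
    simp only [nsmul_eq_mul, mul_ite, mul_zero]
    rw [← Finset.sum_filter]
    have e : (Finset.range (n + 1)).filter (fun m => m < k) = Finset.range k := by
      ext m; simp only [Finset.mem_filter, Finset.mem_range]; omega
    rw [e]
    exact Finset.sum_congr rfl fun j _ => by ring
  · intro S _ T _ hST
    rw [Function.onFun, Set.disjoint_left]
    intro ω hS hT
    exact hST (((hmem S ω).1 hS).symm.trans ((hmem T ω).1 hT))

theorem exp_le_nonneg (x : ℝ) (hx : 0 ≤ x) (hx3 : x < 3) :
    Real.exp x ≤ 1 + x + x ^ 2 * (1 / (2 * (1 - x / 3))) := by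
  have h1 : HasSum (fun j : ℕ => x ^ j / (j.factorial : ℝ)) (Real.exp x) := by
    have := NormedSpace.expSeries_div_hasSum_exp (𝔸 := ℝ) x
    rwa [← Real.exp_eq_exp_ℝ] at this
  have h2 := (hasSum_nat_add_iff' 2).2 h1
  have h3 := (hasSum_geometric_of_lt_one (r := x / 3) (by positivity) (by linarith)).mul_left
    (x ^ 2 / 2)
  have hf : ∀ j : ℕ, (2 : ℝ) * 3 ^ j ≤ ((j + 2).factorial : ℝ) := by
    intro j
    induction j with
    | zero => norm_num [Nat.factorial]
    | succ j ih =>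
      rw [show j + 1 + 2 = (j + 2) + 1 by ring, Nat.factorial_succ]
      push_cast
      have : (0 : ℝ) ≤ j := Nat.cast_nonneg j
      rw [pow_succ]
      nlinarith [pow_pos (show (0 : ℝ) < 3 by norm_num) j]
  have h4 := hasSum_le (fun j => by
    show x ^ (j + 2) / ((j + 2).factorial : ℝ) ≤ x ^ 2 / 2 * (x / 3) ^ j
    have : x ^ 2 / 2 * (x / 3) ^ j = x ^ (j + 2) / (2 * 3 ^ j) := by
      rw [div_pow, pow_add]; field_simp
    rw [this]
    exact div_le_div_of_nonneg_left (by positivity) (by positivity) (hf j)) h2 h3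
  simp [Finset.sum_range_succ] at h4
  have e : x ^ 2 * (1 / (2 * (1 - x / 3))) = x ^ 2 / 2 * (1 - x / 3)⁻¹ := by
    rw [one_div, mul_inv]; ring
  rw [e]
  linarith

theorem exp_neg_le_quad (y : ℝ) (hy : 0 ≤ y) : Real.exp (-y) ≤ 1 - y + y ^ 2 / 2 := by
  have h := Real.quadratic_le_exp_of_nonneg hy
  rw [Real.exp_neg]
  have hp : 0 < 1 - y + y ^ 2 / 2 := by nlinarith [sq_nonneg (y - 1)]
  rw [inv_le_comm₀ (Real.exp_pos y) hp]
  refine le_trans ?_ h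
  rw [inv_le_iff_one_le_mul₀ hp]
  nlinarith [sq_nonneg (y ^ 2)]

theorem bernstein_mgf (p s : ℝ) (h0 : 0 < p) (h1 : p < 1) (hs : 0 ≤ s) (hs3 : s < 3) :
    (1 - p) * Real.exp (s * p) + p * Real.exp (-(s * (1 - p))) ≤
      Real.exp (p * (1 - p) * s ^ 2 * (1 / (2 * (1 - s / 3)))) := by
  set c := 1 / (2 * (1 - s / 3)) with hc
  have hq : 0 < 1 - p := by linarith
  have hsp : s * p ≤ s := by nlinarith
  have hc2 : 1 / 2 ≤ c := by
    rw [hc]; apply one_div_le_one_div_of_le <;> linarith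
  have a1 : Real.exp (s * p) ≤ 1 + s * p + (s * p) ^ 2 * c := by
    refine (exp_le_nonneg _ (by positivity) (by linarith)).trans ?_
    have : 1 / (2 * (1 - s * p / 3)) ≤ c := by
      rw [hc]; apply one_div_le_one_div_of_le <;> linarith
    nlinarith [mul_le_mul_of_nonneg_left this (sq_nonneg (s * p))]
  have a2 : Real.exp (-(s * (1 - p))) ≤ 1 - s * (1 - p) + (s * (1 - p)) ^ 2 * c := by
    refine (exp_neg_le_quad _ (by positivity)).trans ?_
    nlinarith [mul_le_mul_of_nonneg_left hc2 (sq_nonneg (s * (1 - p)))]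
  have a3 := Real.add_one_le_exp (p * (1 - p) * s ^ 2 * c)
  refine le_trans ?_ a3
  have b1 := mul_le_mul_of_nonneg_left a1 hq.le
  have b2 := mul_le_mul_of_nonneg_left a2 h0.le
  refine (add_le_add b1 b2).trans (le_of_eq ?_)
  ring

theorem chernoff (n k : ℕ) (hkn : k ≤ n) (p s : ℝ) (h0 : 0 < p) (h1 : p < 1) (hs : 0 ≤ s) :
    ∑ j ∈ Finset.range (k + 1), (n.choose j : ℝ) * p ^ j * (1 - p) ^ (n - j) ≤
      Real.exp (s * k) * ((1 - p) + p * Real.exp (-s)) ^ n := by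
  have hq : 0 < 1 - p := by linarith
  rw [add_comm (1 - p), add_pow, Finset.mul_sum]
  calc _ ≤ ∑ j ∈ Finset.range (k + 1), Real.exp (s * k) *
        ((p * Real.exp (-s)) ^ j * (1 - p) ^ (n - j) * (n.choose j : ℝ)) := by
        refine Finset.sum_le_sum fun j hj => ?_
        have hjk : (j : ℝ) ≤ k := by
          exact_mod_cast Nat.lt_succ_iff.1 (Finset.mem_range.1 hj)
        have : Real.exp (s * k) *
            ((p * Real.exp (-s)) ^ j * (1 - p) ^ (n - j) * (n.choose j : ℝ)) =
            ((n.choose j : ℝ) * p ^ j * (1 - p) ^ (n - j)) * Real.exp (s * (k - j)) := by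
          rw [mul_pow, ← Real.exp_nat_mul, show s * ((k : ℝ) - j) = s * k + j * (-s) by ring,
            Real.exp_add]
          ring
        rw [this]
        exact le_mul_of_one_le_right (by positivity)
          (Real.one_le_exp (mul_nonneg hs (by linarith)))
    _ ≤ _ := by
        refine Finset.sum_le_sum_of_subset_of_nonneg ?_ (fun j _ _ => by positivity)
        exact Finset.range_mono (by omega)

theorem bernstein_part (n k : ℕ) (p : ℝ) (h0 : 0 < p) (h1 : p < 1)
    (hkn : (k : ℝ) < (n : ℝ) * p) (hle : k ≤ n) :
    (∑ j ∈ Finset.range (k + 1), (n.choose j : ℝ) * p ^ j * (1 - p) ^ (n - j)) ≤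
        Real.exp (-((n : ℝ) *
          ((p - (k : ℝ) / (n : ℝ)) ^ 2 /
            (2 * (p * (1 - p) + (p - (k : ℝ) / (n : ℝ)) / 3))))) := by
  have hq : 0 < 1 - p := by linarith
  have hk0 : (0 : ℝ) ≤ k := Nat.cast_nonneg k
  have hn : (0 : ℝ) < n := by
    by_contra h
    nlinarith
  have ht : 0 < p - (k : ℝ) / n := by
    rw [sub_pos, div_lt_iff₀ hn]; linarith
  have hk : (k : ℝ) = n * (p - (p - (k : ℝ) / n)) := by field_simp; ring
  set t := p - (k : ℝ) / n with htdef
  have hv : 0 < p * (1 - p) := by positivity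
  set v := p * (1 - p) with hvdef
  set s := t / (v + t / 3) with hsdef
  have hs : 0 ≤ s := by positivity
  have hs3 : s < 3 := by
    rw [hsdef, div_lt_iff₀ (by positivity)]; linarith
  refine (chernoff n k hle p s h0 h1 hs).trans ?_
  have e1 : Real.exp (s * k) * ((1 - p) + p * Real.exp (-s)) ^ n =
      (Real.exp (-(s * t)) *
        ((1 - p) * Real.exp (s * p) + p * Real.exp (-(s * (1 - p))))) ^ n := by
    have : (1 - p) * Real.exp (s * p) + p * Real.exp (-(s * (1 - p))) =
        Real.exp (s * p) * ((1 - p) + p * Real.exp (-s)) := by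
      rw [show -(s * (1 - p)) = s * p + -s by ring, Real.exp_add]; ring
    rw [this, ← mul_assoc, ← Real.exp_add, mul_pow, ← Real.exp_nat_mul]
    congr 2
    rw [hk]; ring
  rw [e1]
  have hm := bernstein_mgf p s h0 h1 hs hs3
  calc _ ≤ (Real.exp (-(s * t)) * Real.exp (p * (1 - p) * s ^ 2 * (1 / (2 * (1 - s / 3))))) ^ n := by
        gcongr
    _ = _ := by
        rw [← Real.exp_add, ← Real.exp_nat_mul, ← hvdef]
        congr 1
        have hw : v + t / 3 ≠ 0 := by positivity
        have e2 : 1 - s / 3 = v / (v + t / 3) := by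
          rw [hsdef]; field_simp; ring
        rw [e2, hsdef]
        have hv' := hv.ne'
        clear_value v t
        have hw2 : v * 3 + t ≠ 0 := by positivity
        field_simp
        ring

theorem bottomk_privacy_violation_tail_bound
    (n k : ℕ) (hk : 1 ≤ k) (π0 : ℝ) (h0 : 0 < π0) (h1 : π0 < 1)
    (hkn : (k : ℝ) < (n : ℝ) * π0) :
    ((Measure.pi fun _ : Fin n => volume.restrict (Set.Icc (0 : ℝ) 1))
        {ω | π0 < kthSmallest n k ω}).toReal =
        ∑ j ∈ Finset.range k,
          (n.choose j : ℝ) * π0 ^ j * (1 - π0) ^ (n - j) ∧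
      (∑ j ∈ Finset.range k,
          (n.choose j : ℝ) * π0 ^ j * (1 - π0) ^ (n - j)) ≤
        ∑ j ∈ Finset.range (k + 1),
          (n.choose j : ℝ) * π0 ^ j * (1 - π0) ^ (n - j) ∧
      (∑ j ∈ Finset.range (k + 1),
          (n.choose j : ℝ) * π0 ^ j * (1 - π0) ^ (n - j)) ≤
        Real.exp (-((n : ℝ) *
          ((π0 - (k : ℝ) / (n : ℝ)) ^ 2 /
            (2 * (π0 * (1 - π0) + (π0 - (k : ℝ) / (n : ℝ)) / 3))))) := by
  have hle : k ≤ n := by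
    have hn : (0 : ℝ) ≤ n := Nat.cast_nonneg n
    have : (k : ℝ) ≤ n := by nlinarith
    exact_mod_cast this
  refine ⟨measure_part n k hk hle π0 h0 h1, ?_, bernstein_part n k π0 h0 h1 hkn hle⟩
  have hq : 0 < 1 - π0 := by linarith
  rw [Finset.sum_range_succ]
  exact le_add_of_nonneg_right (by positivity)
end

section
/- Let k, n ≥ 1 be integers, π0 ∈ (0,1], and v := log₂(1/π0). Let (B_1, G_1), …, (B_n, G_n) be i.i.d. random pairs with B_j uniform on {1, …, k}, G_j geometric with Pr(G_j = g) = 2^{−g} for integers g ≥ 1, and B_j independent of G_j. For each bin i ∈ {1, …, k} let s_i := max{ G_j : B_j = i } (with s_i := 0 if no j has B_j = i). Then Pr( (1/k) · Σ_{i=1}^{k} 2^{−s_i} ≥ π0 ) ≤ Pr( ∃ i : s_i ≤ v ) ≤ k · (1 − π0/k)^n ≤ k · exp(−π0 · n / k). -/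
open MeasureTheory

attribute [local instance] Classical.propDecidable

/-- The value stored in bin `i` of a HyperLogLog sketch after `n` i.i.d.
draws: the maximum geometric value hashed to bin `i` (0 if the bin is empty). -/
noncomputable def hllBin (k n : ℕ) (ω : Fin n → Fin k × ℕ) (i : Fin k) : ℕ :=
  (Finset.univ.filter fun j => (ω j).1 = i).sup fun j => (ω j).2

/-!
STATEMENT 19: For the HLL sketch with `k` bins fed by `n` i.i.d. pairs
`(B_j, G_j)` (`B_j` uniform on the bins, `G_j` Geometric(1/2), so `(i,g)` has
probability `(1/k)·2^{−g}` for `g ≥ 1`), with `v := log₂(1/π0)`: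
`Pr((1/k)·Σ_i 2^{−s_i} ≥ π0) ≤ Pr(∃ i, s_i ≤ v) ≤ k(1 − π0/k)^n
  ≤ k·exp(−π0 n/k)`.
-/

lemma hll_aux_tail (k : ℕ) (hk : 1 ≤ k) (μ : Measure (Fin k × ℕ)) [IsProbabilityMeasure μ]
    (hμ : ∀ (i : Fin k) (g : ℕ), 1 ≤ g →
      μ {(i, g)} = ENNReal.ofReal ((1 / (k : ℝ)) * (1 / 2) ^ g)) (i : Fin k) (m : ℕ) :
    μ.real {x | x.1 = i → x.2 ≤ m} = 1 - (1 / (k : ℝ)) * (1 / 2) ^ m := by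
  have hs : {x : Fin k × ℕ | x.1 = i → x.2 ≤ m} = (⋃ g : ℕ, {(i, m + 1 + g)})ᶜ := by
    ext ⟨a, b⟩
    simp only [Set.mem_ofPred_eq, Set.mem_compl_iff, Set.mem_iUnion, Set.mem_singleton_iff,
      Prod.mk.injEq, not_exists, not_and]
    constructor
    · intro h g ha hb
      have := h ha
      omega
    · intro h ha
      by_contra hb
      exact h (b - (m + 1)) ha (by omega)
  have hu : μ (⋃ g : ℕ, {(i, m + 1 + g)}) = ENNReal.ofReal ((1 / (k : ℝ)) * (1 / 2) ^ m) := by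
    rw [measure_iUnion]
    · have hsum : HasSum (fun g : ℕ => (1 / (k : ℝ)) * (1 / 2) ^ (m + 1 + g))
          ((1 / (k : ℝ)) * (1 / 2) ^ m) := by
        have h := hasSum_geometric_two.mul_left ((1 / (k : ℝ)) * (1 / 2) ^ (m + 1))
        have e1 : (fun g : ℕ => (1 / (k : ℝ)) * (1 / 2) ^ (m + 1 + g)) =
            fun g : ℕ => (1 / (k : ℝ)) * (1 / 2) ^ (m + 1) * (1 / 2) ^ g := by
          funext g
          rw [pow_add _ (m + 1) g, mul_assoc]
        have e2 : (1 / (k : ℝ)) * (1 / 2) ^ m = (1 / (k : ℝ)) * (1 / 2) ^ (m + 1) * 2 := by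
          rw [pow_succ]
          ring
        rw [e1, e2]
        exact h
      rw [← hsum.tsum_eq, ENNReal.ofReal_tsum_of_nonneg (fun g => by positivity) hsum.summable]
      exact tsum_congr fun g => hμ i _ (by omega)
    · intro a b hab
      simp only [Function.onFun, Set.disjoint_singleton]
      intro h
      apply hab
      have := congrArg Prod.snd h
      simp only at this
      omega
    · intro g
      exact MeasurableSet.of_discrete
  rw [hs, probReal_compl_eq_one_sub MeasurableSet.of_discrete, measureReal_def, hu,
    ENNReal.toReal_ofReal (by positivity)]

theorem hll_privacy_violation_bound
    (k n : ℕ) (hk : 1 ≤ k) (hn : 1 ≤ n)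
    (π0 : ℝ) (h0 : 0 < π0) (h1 : π0 ≤ 1)
    (μ : Measure (Fin k × ℕ)) [IsProbabilityMeasure μ]
    (hμ : ∀ (i : Fin k) (g : ℕ), 1 ≤ g →
      μ {(i, g)} = ENNReal.ofReal ((1 / (k : ℝ)) * (1 / 2) ^ g)) :
    ((Measure.pi fun _ : Fin n => μ)
        {ω | π0 ≤ (1 / (k : ℝ)) * ∑ i : Fin k, ((2 : ℝ) ^ hllBin k n ω i)⁻¹}).toReal ≤
        ((Measure.pi fun _ : Fin n => μ)
          {ω | ∃ i : Fin k, (hllBin k n ω i : ℝ) ≤ Real.logb 2 (1 / π0)}).toReal ∧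
      ((Measure.pi fun _ : Fin n => μ)
          {ω | ∃ i : Fin k, (hllBin k n ω i : ℝ) ≤ Real.logb 2 (1 / π0)}).toReal ≤
        (k : ℝ) * (1 - π0 / (k : ℝ)) ^ n ∧
      (k : ℝ) * (1 - π0 / (k : ℝ)) ^ n ≤
        (k : ℝ) * Real.exp (-(π0 * (n : ℝ) / (k : ℝ))) := by
  have hk0 : (0 : ℝ) < k := by exact_mod_cast hk
  have hk1 : (1 : ℝ) ≤ k := by exact_mod_cast hk
  have hpk : π0 / k ≤ 1 := by
    rw [div_le_one hk0]
    linarith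
  have key : ∀ s : ℕ, (s : ℝ) ≤ Real.logb 2 (1 / π0) ↔ π0 ≤ ((2 : ℝ) ^ s)⁻¹ := by
    intro s
    rw [Real.le_logb_iff_rpow_le (by norm_num) (by positivity), Real.rpow_natCast, one_div,
      le_inv_comm₀ (by positivity) h0]
  refine ⟨?_, ?_, ?_⟩
  · apply ENNReal.toReal_mono (measure_ne_top _ _)
    apply measure_mono
    intro ω hω
    simp only [Set.mem_ofPred_eq, key] at hω ⊢
    by_contra! hc
    have : Nonempty (Fin k) := ⟨⟨0, hk⟩⟩
    have hlt : ∑ i : Fin k, ((2 : ℝ) ^ hllBin k n ω i)⁻¹ < ∑ i : Fin k, π0 :=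
      Finset.sum_lt_sum_of_nonempty Finset.univ_nonempty fun i _ => hc i
    rw [Finset.sum_const, Finset.card_univ, Fintype.card_fin, nsmul_eq_mul] at hlt
    have h2 := mul_lt_mul_of_pos_left hlt (by positivity : 0 < 1 / (k : ℝ))
    rw [← mul_assoc, one_div_mul_cancel hk0.ne', one_mul] at h2
    linarith
  · set v := Real.logb 2 (1 / π0) with hv
    have hv0 : 0 ≤ v := by
      have := (key 0).2 (by simpa using h1)
      simpa using this
    set m := ⌊v⌋₊ with hm
    have hmv : π0 ≤ (1 / 2 : ℝ) ^ m := by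
      have := (key m).1 (Nat.floor_le hv0)
      simpa using this
    have hset : {ω : Fin n → Fin k × ℕ | ∃ i : Fin k, (hllBin k n ω i : ℝ) ≤ v} =
        ⋃ i : Fin k, Set.pi Set.univ fun _ : Fin n => {x : Fin k × ℕ | x.1 = i → x.2 ≤ m} := by
      ext ω
      simp only [Set.mem_ofPred_eq, Set.mem_iUnion, Set.mem_pi, Set.mem_univ, true_imp_iff]
      refine exists_congr fun i => ?_
      rw [← Nat.le_floor_iff hv0, hllBin, Finset.sup_le_iff]
      simp [hm]
    rw [hset, ← measureReal_def]
    refine (measureReal_iUnion_fintype_le _).trans ?_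
    have hb : ∀ i ∈ (Finset.univ : Finset (Fin k)), (Measure.pi fun _ : Fin n => μ).real
        (Set.pi Set.univ fun _ : Fin n => {x : Fin k × ℕ | x.1 = i → x.2 ≤ m}) ≤
        (1 - π0 / k) ^ n := by
      intro i _
      rw [measureReal_def, Measure.pi_pi, Finset.prod_const, Finset.card_univ, Fintype.card_fin,
        ENNReal.toReal_pow, ← measureReal_def]
      apply pow_le_pow_left₀ measureReal_nonneg
      rw [hll_aux_tail k hk μ hμ i m]
      have := mul_le_mul_of_nonneg_left hmv (by positivity : 0 ≤ 1 / (k : ℝ))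
      have e : π0 / k = 1 / (k : ℝ) * π0 := by ring
      rw [e]
      linarith
    refine (Finset.sum_le_sum hb).trans ?_
    simp
  · apply mul_le_mul_of_nonneg_left _ hk0.le
    have h := pow_le_pow_left₀ (by linarith) (Real.one_sub_le_exp_neg (π0 / k)) n
    refine h.trans (le_of_eq ?_)
    rw [← Real.exp_nat_mul]
    congr 1
    ring
end
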